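/- Fix ε > 0. There is a constant A > 0 such that for all sufficiently large D there exist at least D^{1−ε} fundamental discriminants d ≤ D for which 𝓛_{χ_d} ≥ log log log D − A and L(s, χ_d) has no Siegel zero. -/

import Mathlib

open Filter

/-- The Dirichlet L-function of `χ` (extended by `0` for modulus `0`). -/
noncomputable def LFun (d : ℕ) (χ : DirichletCharacter ℂ d) (s : ℂ) : ℂ :=
  if h : d ≠ 0 then
    letI : NeZero d := ⟨h⟩
    DirichletCharacter.LFunction χ s
  else 0

/-- `𝓛_χ = Σ_p χ(p)/p` has value `L`: the partial sums over primes `p < y`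
converge to `L` as `y → ∞`. -/
def HasCurlyL {d : ℕ} (χ : DirichletCharacter ℂ d) (L : ℝ) : Prop :=
  Filter.Tendsto
    (fun y : ℕ => ∑ p ∈ (Finset.range y).filter Nat.Prime, (χ p).re / (p : ℝ))
    Filter.atTop (nhds L)

/-- Number of ordered pairs `(p, q)` of primes with `p * q ≤ x` satisfying `P p q`. -/
noncomputable def pairCount (x : ℝ) (P : ℕ → ℕ → Prop) : ℕ :=
  Nat.card {pq : ℕ × ℕ // pq.1.Prime ∧ pq.2.Prime ∧ ((pq.1 * pq.2 : ℕ) : ℝ) ≤ x ∧ P pq.1 pq.2}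

/-- The race ratio `#{pq ≤ x : χ(p) = χ(q) = η} / ((1/4) #{pq ≤ x : gcd(pq, d) = 1})`,
where products of two primes are counted as ordered pairs. -/
noncomputable def raceRatio {d : ℕ} (χ : DirichletCharacter ℂ d) (η : ℂ) (x : ℝ) : ℝ :=
  (pairCount x (fun p q => χ p = η ∧ χ q = η) : ℝ) /
    ((1 / 4 : ℝ) * (pairCount x (fun p q => Nat.gcd (p * q) d = 1) : ℝ))

/-- A positive integer is a fundamental discriminant if it is `≡ 1 (mod 4)` and squarefree,
or is `4m` with `m ≡ 2, 3 (mod 4)` squarefree. -/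
def IsFundamentalDiscriminant (d : ℕ) : Prop :=
  0 < d ∧ ((d % 4 = 1 ∧ Squarefree d) ∨
    (d % 4 = 0 ∧ Squarefree (d / 4) ∧ (d / 4 % 4 = 2 ∨ d / 4 % 4 = 3)))

/-- The Generalized Riemann Hypothesis for Dirichlet L-functions: all zeros in the
critical strip lie on the critical line. -/
def GRH : Prop :=
  ∀ (d : ℕ), d ≠ 0 → ∀ (χ : DirichletCharacter ℂ d) (s : ℂ),
    LFun d χ s = 0 → 0 < s.re → s.re < 1 → s.re = 1 / 2

/-- `L(s, χ)` has no real zero `β` with `1 - c / log d ≤ β ≤ 1` (a Siegel zero). -/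
def HasNoSiegelZero (c : ℝ) (d : ℕ) (χ : DirichletCharacter ℂ d) : Prop :=
  ¬ ∃ β : ℝ, 1 - c / Real.log d ≤ β ∧ β ≤ 1 ∧ LFun d χ (β : ℂ) = 0

/-- The logarithmic integral `Li(t) = ∫_2^t du / log u`. -/
noncomputable def Li (t : ℝ) : ℝ := ∫ u in (2:ℝ)..t, 1 / Real.log u

/-! ### Summation by parts -/

theorem abel_identity (f g : ℕ → ℝ) (M N : ℕ) (h : M ≤ N) :
    ∑ n ∈ Finset.Ioc M N, f n * g n =
      (∑ n ∈ Finset.Ioc M N, f n) * g (N + 1) +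
        ∑ n ∈ Finset.Ioc M N, (∑ k ∈ Finset.Ioc M n, f k) * (g n - g (n + 1)) := by
  induction N, h using Nat.le_induction with
  | base => simp
  | succ N h ih =>
    rw [Finset.sum_Ioc_succ_top (by omega), ih, Finset.sum_Ioc_succ_top (by omega) (fun n => (∑ k ∈ Finset.Ioc M n, f k) * (g n - g (n + 1))),
      Finset.sum_Ioc_succ_top (by omega) f]
    ring

theorem abel_bound (f g : ℕ → ℝ) (b : ℝ) (M N : ℕ) (h : M ≤ N)
    (hf : ∀ n, M ≤ n → |∑ k ∈ Finset.Ioc M n, f k| ≤ b)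
    (hg0 : ∀ n, M < n → 0 ≤ g n) (hg : ∀ n, M < n → g (n + 1) ≤ g n) :
    |∑ n ∈ Finset.Ioc M N, f n * g n| ≤ b * g (M + 1) := by
  rw [abel_identity f g M N h]
  have htel : ∑ n ∈ Finset.Ioc M N, (g n - g (n + 1)) = g (M + 1) - g (N + 1) := by
    induction N, h using Nat.le_induction with
    | base => simp
    | succ N h ih => rw [Finset.sum_Ioc_succ_top (by omega), ih]; ring
  calc _ ≤ |(∑ n ∈ Finset.Ioc M N, f n) * g (N + 1)| +
        |∑ n ∈ Finset.Ioc M N, (∑ k ∈ Finset.Ioc M n, f k) * (g n - g (n + 1))| := abs_add_le _ _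
    _ ≤ b * g (N + 1) + ∑ n ∈ Finset.Ioc M N, b * (g n - g (n + 1)) := by
        gcongr
        · rw [abs_mul, abs_of_nonneg (hg0 (N + 1) (by omega))]
          exact mul_le_mul_of_nonneg_right (hf N h) (hg0 (N + 1) (by omega))
        · refine (Finset.abs_sum_le_sum_abs _ _).trans (Finset.sum_le_sum fun n hn => ?_)
          rw [Finset.mem_Ioc] at hn
          have := hg n hn.1
          rw [abs_mul, abs_of_nonneg (a := g n - g (n + 1)) (by linarith)]
          exact mul_le_mul_of_nonneg_right (hf n hn.1.le) (by linarith)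
    _ = b * g (M + 1) := by rw [← Finset.mul_sum, htel]; ring

theorem sum_Ioc_split (f : ℕ → ℝ) {M N : ℕ} (h : M ≤ N) :
    ∑ n ∈ Finset.Ioc 0 N, f n = ∑ n ∈ Finset.Ioc 0 M, f n + ∑ n ∈ Finset.Ioc M N, f n :=
  (Finset.sum_Ioc_consecutive f (Nat.zero_le M) h).symm

theorem Ioc_bound_of_bound {f : ℕ → ℝ} {B : ℝ} (hf : ∀ n, |∑ k ∈ Finset.Ioc 0 n, f k| ≤ B)
    (M n : ℕ) (h : M ≤ n) : |∑ k ∈ Finset.Ioc M n, f k| ≤ 2 * B := by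
  have h1 := sum_Ioc_split f h
  have h2 := abs_le.1 (hf n)
  have h3 := abs_le.1 (hf M)
  rw [abs_le]; constructor <;> linarith

/-- Dirichlet's test with a tail bound. -/
theorem dirichlet_test (f g : ℕ → ℝ) (B : ℝ) (n0 : ℕ)
    (hf : ∀ n, |∑ k ∈ Finset.Ioc 0 n, f k| ≤ B)
    (hg0 : ∀ n, n0 ≤ n → 0 ≤ g n) (hg : ∀ n, n0 ≤ n → g (n + 1) ≤ g n)
    (hlim : Tendsto g atTop (nhds 0)) :
    ∃ l : ℝ, Tendsto (fun N => ∑ n ∈ Finset.Ioc 0 N, f n * g n) atTop (nhds l) ∧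
      ∀ N, n0 ≤ N + 1 → |l - ∑ n ∈ Finset.Ioc 0 N, f n * g n| ≤ 2 * B * g (N + 1) := by
  have key : ∀ M N, n0 ≤ M + 1 → M ≤ N → |∑ n ∈ Finset.Ioc 0 N, f n * g n -
      ∑ n ∈ Finset.Ioc 0 M, f n * g n| ≤ 2 * B * g (M + 1) := by
    intro M N h0 h
    rw [sum_Ioc_split _ h, add_sub_cancel_left]
    exact abel_bound f g (2 * B) M N h (fun n hn => Ioc_bound_of_bound hf M n hn)
      (fun n hn => hg0 n (by omega)) (fun n hn => hg n (by omega))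
  have hc : CauchySeq (fun N => ∑ n ∈ Finset.Ioc 0 N, f n * g n) := by
    refine cauchySeq_of_le_tendsto_0' (fun M => if n0 ≤ M + 1 then 2 * (2 * B * g (M + 1)) else 0 + (∑ n ∈ Finset.Ioc 0 (M + n0), |f n * g n|) * 2 + 2 * (2 * B * g (M + n0 + 1))) ?_ ?_
    · intro M N h
      by_cases h0 : n0 ≤ M + 1
      · simp only [h0, if_true]
        rw [dist_comm, Real.dist_eq]
        have := key M N h0 h
        have h2 := abs_nonneg (∑ n ∈ Finset.Ioc 0 N, f n * g n - ∑ n ∈ Finset.Ioc 0 M, f n * g n)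
        linarith
      · simp only [h0, if_false]
        have hB : 0 ≤ B := (abs_nonneg _).trans (hf 0)
        have a1 : ∀ K, K ≤ M + n0 → |∑ n ∈ Finset.Ioc 0 K, f n * g n| ≤ ∑ n ∈ Finset.Ioc 0 (M + n0), |f n * g n| := by
          intro K hK
          refine (Finset.abs_sum_le_sum_abs _ _).trans (Finset.sum_le_sum_of_subset_of_nonneg ?_ fun _ _ _ => abs_nonneg _)
          exact Finset.Ioc_subset_Ioc_right hK
        have hg' := hg0 (M + n0 + 1) (by omega)
        have hp : 0 ≤ 2 * B * g (M + n0 + 1) := by positivity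
        rw [dist_comm, Real.dist_eq]
        have hM := abs_le.1 (a1 M (by omega))
        rcases le_total N (M + n0) with hN | hN
        · have hN' := abs_le.1 (a1 N hN)
          rw [abs_le]; constructor <;> linarith
        · have := abs_le.1 (key (M + n0) N (by omega) hN)
          have hN' := abs_le.1 (a1 (M + n0) le_rfl)
          rw [abs_le]; constructor <;> linarith
    · have h1 : Tendsto (fun M => 2 * (2 * B * g (M + 1))) atTop (nhds 0) := by
        have := (hlim.comp (tendsto_add_atTop_nat 1)).const_mul (2 * (2 * B))
        simpa [mul_assoc, Function.comp_def] using this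
      refine h1.congr' ?_
      filter_upwards [eventually_ge_atTop n0] with M hM
      rw [if_pos (by omega)]
  obtain ⟨l, hl⟩ := cauchySeq_tendsto_of_complete hc
  refine ⟨l, hl, fun N hN => ?_⟩
  have h1 := (hl.sub_const (∑ n ∈ Finset.Ioc 0 N, f n * g n)).abs
  refine le_of_tendsto h1 ?_
  filter_upwards [eventually_ge_atTop N] with K hK
  exact key N K hN hK

/-- Abel's limit theorem, uniform version. -/
theorem abel_limit (a : ℕ → ℝ) (L : ℝ)
    (h : Tendsto (fun N => ∑ n ∈ Finset.Ioc 0 N, a n) atTop (nhds L)) (η : ℝ) (hη : 0 < η) :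
    ∃ M, ∀ᶠ δ : ℝ in nhdsWithin 0 (Set.Ioi 0), ∀ N, M ≤ N →
      |∑ n ∈ Finset.Ioc 0 N, a n * (n : ℝ) ^ (-δ) - L| ≤ η := by
  have hη4 : 0 < η / 4 := by linarith
  obtain ⟨M, hM⟩ := Metric.tendsto_atTop.1 h (η / 4) hη4
  refine ⟨M, ?_⟩
  have hfin : Tendsto (fun δ : ℝ => ∑ n ∈ Finset.Ioc 0 M, a n * (n : ℝ) ^ (-δ)) (nhdsWithin 0 (Set.Ioi 0))
      (nhds (∑ n ∈ Finset.Ioc 0 M, a n)) := by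
    refine tendsto_finset_sum _ fun n hn => ?_
    have hn0 : (n : ℝ) ≠ 0 := by
      have := (Finset.mem_Ioc.1 hn).1
      positivity
    have hc : Continuous (fun δ : ℝ => a n * (n : ℝ) ^ (-δ)) :=
      continuous_const.mul (continuous_const.rpow continuous_neg (fun _ => Or.inl hn0))
    have := hc.tendsto 0
    simp only [neg_zero, Real.rpow_zero, mul_one] at this
    exact this.mono_left nhdsWithin_le_nhds
  have h2 := Metric.tendsto_nhds.1 hfin (η / 4) hη4
  filter_upwards [h2, self_mem_nhdsWithin] with δ hδ hpos N hN
  have hpos : 0 < δ := hpos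
  have hb : ∀ n, M ≤ n → |∑ k ∈ Finset.Ioc M n, a k| ≤ η / 2 := by
    intro n hn
    have h1 := hM n hn
    have h2 := hM M le_rfl
    rw [Real.dist_eq, abs_lt] at h1 h2
    have h3 := sum_Ioc_split a hn
    rw [abs_le]; constructor <;> linarith
  have h3 := abel_bound a (fun n => (n : ℝ) ^ (-δ)) (η / 2) M N hN hb (fun n _ => by positivity)
    (fun n hn => by
      refine Real.rpow_le_rpow_of_nonpos ?_ ?_ (by linarith)
      · have : 0 < n := by omega
        positivity
      · push_cast; linarith)
  have h4 : ((M + 1 : ℕ) : ℝ) ^ (-δ) ≤ 1 := by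
    refine Real.rpow_le_one_of_one_le_of_nonpos ?_ (by linarith)
    push_cast; linarith [(Nat.cast_nonneg M : (0 : ℝ) ≤ M)]
  have h5 : |∑ n ∈ Finset.Ioc M N, a n * (n : ℝ) ^ (-δ)| ≤ η / 2 :=
    h3.trans (by nlinarith)
  rw [sum_Ioc_split _ hN]
  have h6 := hM M le_rfl
  rw [Real.dist_eq, abs_lt] at h6 hδ
  rw [abs_le] at h5 ⊢
  constructor <;> linarith

theorem sum_divisors_hyperbola (F : ℕ → ℕ → ℝ) (x : ℕ) :
    ∑ n ∈ Finset.Ioc 0 x, ∑ q ∈ n.divisorsAntidiagonal, F q.1 q.2 =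
      ∑ m ∈ Finset.Ioc 0 x, ∑ k ∈ Finset.Ioc 0 (x / m), F m k := by
  rw [Finset.sum_sigma', Finset.sum_sigma']
  refine Finset.sum_bij' (fun p _ => ⟨p.2.1, p.2.2⟩) (fun p _ => ⟨p.1 * p.2, (p.1, p.2)⟩) ?_ ?_ ?_ ?_ ?_
  · rintro ⟨n, a, b⟩ h
    simp only [Finset.mem_sigma, Finset.mem_Ioc, Nat.mem_divisorsAntidiagonal] at h ⊢
    obtain ⟨⟨h1, h2⟩, rfl, h3⟩ := h
    have ha : 0 < a := Nat.pos_of_ne_zero (by rintro rfl; simp at h3)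
    have hb : 0 < b := Nat.pos_of_ne_zero (by rintro rfl; simp at h3)
    refine ⟨⟨ha, le_trans (Nat.le_mul_of_pos_right a hb) h2⟩, hb, ?_⟩
    rw [Nat.le_div_iff_mul_le ha, mul_comm]; exact h2
  · rintro ⟨a, b⟩ h
    simp only [Finset.mem_sigma, Finset.mem_Ioc, Nat.mem_divisorsAntidiagonal] at h ⊢
    obtain ⟨⟨h1, h2⟩, h3, h4⟩ := h
    rw [Nat.le_div_iff_mul_le h1, mul_comm] at h4
    have : 0 < a * b := Nat.mul_pos h1 h3
    exact ⟨⟨this, h4⟩, trivial, this.ne'⟩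
  · rintro ⟨n, a, b⟩ h
    simp only [Finset.mem_sigma, Finset.mem_Ioc, Nat.mem_divisorsAntidiagonal] at h
    obtain ⟨⟨h1, h2⟩, rfl, h3⟩ := h
    rfl
  · rintro ⟨a, b⟩ h; rfl
  · rintro ⟨n, a, b⟩ h; rfl

/-! ### Partial sums of `k ^ (κ - 1)` -/

theorem rpow_diff_le (κ a b : ℝ) (hκ : 0 < κ) (hκ1 : κ < 1) (ha : 0 < a) (hb : 0 < b) :
    (b ^ κ - a ^ κ) / κ ≤ (b - a) * a ^ (κ - 1) := by
  have h := rpow_one_add_le_one_add_mul_self (s := b / a - 1) (by have := div_pos hb ha; linarith) hκ.le hκ1.le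
  have e1 : b ^ κ = a ^ κ * (1 + (b / a - 1)) ^ κ := by
    rw [← Real.mul_rpow ha.le (by have := div_pos hb ha; linarith)]
    congr 1; field_simp; ring
  have e2 : a ^ (κ - 1) = a ^ κ / a := by rw [Real.rpow_sub ha, Real.rpow_one]
  have hp : 0 < a ^ κ := Real.rpow_pos_of_pos ha κ
  rw [div_le_iff₀ hκ, e1, e2]
  have := mul_le_mul_of_nonneg_left h hp.le
  have e3 : (b - a) * (a ^ κ / a) * κ = a ^ κ * (1 + κ * (b / a - 1)) - a ^ κ := by
    field_simp; ring
  rw [e3]; linarith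

theorem rpow_diff_ge (κ a b : ℝ) (hκ : 0 < κ) (hκ1 : κ < 1) (ha : 0 < a) (hb : 0 < b) :
    (b - a) * b ^ (κ - 1) ≤ (b ^ κ - a ^ κ) / κ := by
  have := rpow_diff_le κ b a hκ hκ1 hb ha
  have e : (a ^ κ - b ^ κ) / κ = - ((b ^ κ - a ^ κ) / κ) := by ring
  rw [e] at this
  linarith

theorem hsum_upper (κ : ℝ) (hκ : 0 < κ) (hκ1 : κ < 1) (n v : ℕ) (hn : 1 ≤ n) (h : n ≤ v) :
    ∑ k ∈ Finset.Ioc n v, (k : ℝ) ^ (κ - 1) ≤ ((v : ℝ) ^ κ - (n : ℝ) ^ κ) / κ := by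
  induction v, h using Nat.le_induction with
  | base => simp
  | succ v h ih =>
    rw [Finset.sum_Ioc_succ_top (by omega)]
    have hv : (0 : ℝ) < v := by exact_mod_cast (by omega : 0 < v)
    have := rpow_diff_ge κ v ((v + 1 : ℕ) : ℝ) hκ hκ1 hv (by positivity)
    push_cast at this ⊢
    have e : (((v : ℝ) + 1) ^ κ - (n : ℝ) ^ κ) / κ = (((v : ℝ) + 1) ^ κ - (v : ℝ) ^ κ) / κ + ((v : ℝ) ^ κ - (n : ℝ) ^ κ) / κ := by ring
    rw [e]; linarith

theorem hsum_lower (κ : ℝ) (hκ : 0 < κ) (hκ1 : κ < 1) (n v : ℕ) (h : n ≤ v) :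
    (((v + 1 : ℕ) : ℝ) ^ κ - ((n + 1 : ℕ) : ℝ) ^ κ) / κ ≤ ∑ k ∈ Finset.Ioc n v, (k : ℝ) ^ (κ - 1) := by
  induction v, h using Nat.le_induction with
  | base => simp
  | succ v h ih =>
    rw [Finset.sum_Ioc_succ_top (by omega)]
    have := rpow_diff_le κ ((v + 1 : ℕ) : ℝ) ((v + 1 + 1 : ℕ) : ℝ) hκ hκ1 (by positivity) (by positivity)
    push_cast at this ih ⊢
    have e : (((v : ℝ) + 1 + 1) ^ κ - ((n : ℝ) + 1) ^ κ) / κ = (((v : ℝ) + 1 + 1) ^ κ - ((v : ℝ) + 1) ^ κ) / κ + (((v : ℝ) + 1) ^ κ - ((n : ℝ) + 1) ^ κ) / κ := by ring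
    rw [e]; linarith

theorem h_diff (κ : ℝ) (hκ : 0 < κ) (hκ1 : κ < 1) (u : ℝ) (hu : 1 ≤ u) (v : ℕ) (hv : ⌊u⌋₊ ≤ v) :
    |(∑ k ∈ Finset.Ioc 0 v, (k : ℝ) ^ (κ - 1) - (v : ℝ) ^ κ / κ) -
      (∑ k ∈ Finset.Ioc 0 ⌊u⌋₊, (k : ℝ) ^ (κ - 1) - u ^ κ / κ)| ≤ (⌊u⌋₊ : ℝ) ^ (κ - 1) := by
  set n := ⌊u⌋₊ with hn
  have hn1 : 1 ≤ n := Nat.le_floor (by simpa using hu)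
  have hn0 : (0 : ℝ) < n := by exact_mod_cast hn1
  have hnu : (n : ℝ) ≤ u := Nat.floor_le (by linarith)
  have hun : u < n + 1 := Nat.lt_floor_add_one u
  have h1 := hsum_upper κ hκ hκ1 n v hn1 hv
  have h2 := hsum_lower κ hκ hκ1 n v hv
  rw [sum_Ioc_split _ hv]
  have hp : 0 < (n : ℝ) ^ (κ - 1) := Real.rpow_pos_of_pos hn0 _
  have h3 := rpow_diff_le κ n u hκ hκ1 hn0 (by linarith)
  have h4 := rpow_diff_le κ u (n + 1) hκ hκ1 (by linarith) (by linarith)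
  have h5 : (u - n) * (n : ℝ) ^ (κ - 1) ≤ (n : ℝ) ^ (κ - 1) := by nlinarith
  have h6 : u ^ (κ - 1) ≤ (n : ℝ) ^ (κ - 1) := Real.rpow_le_rpow_of_nonpos hn0 hnu (by linarith)
  have h7 : (n + 1 - u) * u ^ (κ - 1) ≤ (n : ℝ) ^ (κ - 1) := by
    have : 0 < u ^ (κ - 1) := Real.rpow_pos_of_pos (by linarith) _
    nlinarith
  have h8 : (v : ℝ) ^ κ ≤ ((v + 1 : ℕ) : ℝ) ^ κ := by
    apply Real.rpow_le_rpow (by positivity) _ hκ.le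
    push_cast; linarith
  have h9 : (v : ℝ) ^ κ / κ ≤ ((v + 1 : ℕ) : ℝ) ^ κ / κ := by gcongr
  rw [sub_div] at h1 h2 h3 h4
  push_cast at h2 h9
  rw [abs_le]; constructor <;> linarith

theorem h_asymp (κ : ℝ) (hκ : 0 < κ) (hκ1 : κ < 1) :
    ∃ C : ℝ, |C| ≤ 1 / κ ∧ ∀ u : ℝ, 1 ≤ u →
      |∑ k ∈ Finset.Ioc 0 ⌊u⌋₊, (k : ℝ) ^ (κ - 1) - u ^ κ / κ - C| ≤ 2 * u ^ (κ - 1) := by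
  set e : ℕ → ℝ := fun v => ∑ k ∈ Finset.Ioc 0 (v + 1), (k : ℝ) ^ (κ - 1) - ((v + 1 : ℕ) : ℝ) ^ κ / κ with he
  have hanti : Antitone e := by
    refine antitone_nat_of_succ_le fun v => ?_
    have := rpow_diff_ge κ ((v + 1 : ℕ) : ℝ) ((v + 1 + 1 : ℕ) : ℝ) hκ hκ1 (by positivity) (by positivity)
    simp only [he]
    rw [Finset.sum_Ioc_succ_top (by omega)]
    rw [sub_div] at this
    push_cast at this ⊢
    linarith
  have hd : ∀ u : ℝ, 1 ≤ u → ∀ v, ⌊u⌋₊ ≤ v + 1 → |e v - (∑ k ∈ Finset.Ioc 0 ⌊u⌋₊, (k : ℝ) ^ (κ - 1) - u ^ κ / κ)| ≤ (⌊u⌋₊ : ℝ) ^ (κ - 1) :=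
    fun u hu v hv => h_diff κ hκ hκ1 u hu (v + 1) hv
  have h1 : ∀ v, - (1 / κ) ≤ e v := by
    intro v
    have := hd 1 le_rfl v (by simp)
    simp only [Nat.floor_one, Nat.cast_one, Real.one_rpow] at this
    have := (abs_le.1 this).1
    simp at this
    have e2 : 1 / κ = κ⁻¹ := by simp
    linarith
  have hbb : BddBelow (Set.range e) := ⟨_, by rintro _ ⟨v, rfl⟩; exact h1 v⟩
  have hlim := tendsto_atTop_ciInf hanti hbb
  set C := ⨅ v, e v with hC
  have hC1 : -(1 / κ) ≤ C := le_ciInf h1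
  have hC2 : C ≤ 1 / κ := by
    have h2 : C ≤ e 0 := ciInf_le hbb 0
    have h3 : e 0 = 1 - 1 / κ := by simp [he]
    have h4 : 1 ≤ 1 / κ := by rw [le_div_iff₀ hκ]; linarith
    linarith
  refine ⟨C, abs_le.2 ⟨hC1, hC2⟩, fun u hu => ?_⟩
  have hn1 : 1 ≤ ⌊u⌋₊ := Nat.le_floor (by simpa using hu)
  have hn0 : (1 : ℝ) ≤ ⌊u⌋₊ := by exact_mod_cast hn1
  have hun : u < ⌊u⌋₊ + 1 := Nat.lt_floor_add_one u
  have h5 : (⌊u⌋₊ : ℝ) ^ (κ - 1) ≤ 2 * u ^ (κ - 1) := by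
    have h6 : (⌊u⌋₊ : ℝ) ^ (κ - 1) ≤ (u / 2) ^ (κ - 1) :=
      Real.rpow_le_rpow_of_nonpos (by linarith) (by linarith) (by linarith)
    rw [Real.div_rpow (by linarith) (by norm_num)] at h6
    have h7 : (2 : ℝ)⁻¹ ≤ 2 ^ (κ - 1) := by
      rw [← Real.rpow_neg_one]
      exact Real.rpow_le_rpow_of_exponent_le (by norm_num) (by linarith)
    have hu0 : 0 < u ^ (κ - 1) := Real.rpow_pos_of_pos (by linarith) _
    refine h6.trans ?_
    rw [div_le_iff₀ (by positivity)]
    nlinarith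
  refine le_trans ?_ h5
  have h8 := (hlim.sub_const (∑ k ∈ Finset.Ioc 0 ⌊u⌋₊, (k : ℝ) ^ (κ - 1) - u ^ κ / κ)).abs
  rw [abs_sub_comm]
  refine le_of_tendsto h8 ?_
  filter_upwards [eventually_ge_atTop ⌊u⌋₊] with v hv
  exact hd u hu v (by omega)

/-! ### Real completely multiplicative functions with values in `{0, 1, -1}` -/

structure RC (f : ℕ → ℝ) : Prop where
  zero : f 0 = 0
  one : f 1 = 1
  mul : ∀ m n, f (m * n) = f m * f n
  tri : ∀ n, f n = 0 ∨ f n = 1 ∨ f n = -1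

theorem RC.abs_le_one {f : ℕ → ℝ} (hf : RC f) (n : ℕ) : |f n| ≤ 1 := by
  rcases hf.tri n with h | h | h <;> simp [h]

theorem RC.pow {f : ℕ → ℝ} (hf : RC f) (n k : ℕ) : f (n ^ k) = f n ^ k := by
  induction k with
  | zero => simp [hf.one]
  | succ k ih => rw [pow_succ, hf.mul, ih, pow_succ]

theorem RC.r_nonneg {f : ℕ → ℝ} (hf : RC f) (n : ℕ) :
    0 ≤ ∑ q ∈ n.divisorsAntidiagonal, f q.1 := by
  rcases n.eq_zero_or_pos with rfl | hn
  · simp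
  set F : ArithmeticFunction ℝ := ⟨f, hf.zero⟩ with hF
  have hFm : F.IsMultiplicative := ⟨hf.one, fun {m n} _ => hf.mul m n⟩
  have hm : (F * (ArithmeticFunction.zeta : ArithmeticFunction ℝ)).IsMultiplicative :=
    hFm.mul ArithmeticFunction.isMultiplicative_zeta.natCast
  have e : ∀ k, 0 < k → (F * (ArithmeticFunction.zeta : ArithmeticFunction ℝ)) k = ∑ q ∈ k.divisorsAntidiagonal, f q.1 := by
    intro k hk
    rw [ArithmeticFunction.mul_apply]
    refine Finset.sum_congr rfl fun q hq => ?_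
    have : q.2 ≠ 0 := by
      rw [Nat.mem_divisorsAntidiagonal] at hq
      rintro h; simp [h] at hq; omega
    simp [this, hF]
  rw [← e n hn, ArithmeticFunction.IsMultiplicative.multiplicative_factorization _ hm hn.ne']
  refine Finset.prod_nonneg fun p hp => ?_
  have hp' : p.Prime := Nat.prime_of_mem_primeFactors hp
  show 0 ≤ (F * (ArithmeticFunction.zeta : ArithmeticFunction ℝ)) (p ^ n.factorization p)
  rw [e _ (pow_pos hp'.pos _), Nat.sum_divisorsAntidiagonal (f := fun i _ => f i), Nat.sum_divisors_prime_pow hp']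
  simp_rw [hf.pow]
  rcases hf.tri p with h | h | h
  · rw [h]; exact Finset.sum_nonneg fun i _ => by positivity
  · rw [h]; exact Finset.sum_nonneg fun i _ => by positivity
  · rw [h]
    rw [neg_one_geom_sum]
    split_ifs <;> norm_num

theorem siegel_ineq {f : ℕ → ℝ} (hf : RC f) (B : ℝ)
    (hB : ∀ n, |∑ k ∈ Finset.Ioc 0 n, f k| ≤ B) (κ : ℝ) (hκ : 0 < κ) (hκ1 : κ < 1)
    (hL : Tendsto (fun N => ∑ n ∈ Finset.Ioc 0 N, f n * (n : ℝ) ^ (κ - 1)) atTop (nhds 0))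
    (x : ℕ) (hx : 1 ≤ x) :
    ∑ n ∈ Finset.Ioc 0 x, f n / n ≤
      κ * (∑ m ∈ Finset.Ioc 0 x, f m / m * ∑ k ∈ Finset.Ioc 0 (x / m), 1 / (k : ℝ)) +
        2 * κ + 2 * B / x := by
  set S := ∑ n ∈ Finset.Ioc 0 x, f n / n with hS
  set R := ∑ m ∈ Finset.Ioc 0 x, f m / m * ∑ k ∈ Finset.Ioc 0 (x / m), 1 / (k : ℝ) with hR
  have hx0 : (0 : ℝ) < x := by exact_mod_cast hx
  obtain ⟨C, hC, hC2⟩ := h_asymp κ hκ hκ1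
  have hB0 : 0 ≤ B := (abs_nonneg _).trans (hB 0)
  -- the tail
  have hZ : |∑ n ∈ Finset.Ioc 0 x, f n * (n : ℝ) ^ (κ - 1)| ≤ 2 * B * (x : ℝ) ^ (κ - 1) := by
    obtain ⟨l, hl, hl2⟩ := dirichlet_test f (fun n => (n : ℝ) ^ (κ - 1)) B 1 hB
      (fun n _ => by positivity)
      (fun n hn => Real.rpow_le_rpow_of_nonpos (by exact_mod_cast hn) (by push_cast; linarith) (by linarith))
      (by
        have := (tendsto_rpow_neg_atTop (y := 1 - κ) (by linarith)).comp tendsto_natCast_atTop_atTop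
        simpa [Function.comp_def] using this)
    have : l = 0 := tendsto_nhds_unique hl hL
    have h1 := hl2 x (by omega)
    rw [this, zero_sub, abs_neg] at h1
    refine h1.trans (mul_le_mul_of_nonneg_left ?_ (by positivity))
    exact Real.rpow_le_rpow_of_nonpos hx0 (by push_cast; linarith) (by linarith)
  -- Q
  have hQ := sum_divisors_hyperbola (fun m k => f m * ((m : ℝ) ^ (κ - 1) * (k : ℝ) ^ (κ - 1))) x
  have hQR := sum_divisors_hyperbola (fun m k => f m * (1 / (m : ℝ) * (1 / (k : ℝ)))) x
  have hQle : ∑ n ∈ Finset.Ioc 0 x, ∑ q ∈ n.divisorsAntidiagonal, f q.1 * ((q.1 : ℝ) ^ (κ - 1) * (q.2 : ℝ) ^ (κ - 1))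
      ≤ (x : ℝ) ^ κ * R := by
    have hR' : R = ∑ n ∈ Finset.Ioc 0 x, ∑ q ∈ n.divisorsAntidiagonal, f q.1 * (1 / (q.1 : ℝ) * (1 / (q.2 : ℝ))) := by
      rw [hQR, hR]
      refine Finset.sum_congr rfl fun m _ => ?_
      rw [Finset.mul_sum]
      refine Finset.sum_congr rfl fun k _ => ?_
      ring
    rw [hR', Finset.mul_sum]
    refine Finset.sum_le_sum fun n hn => ?_
    rw [Finset.mem_Ioc] at hn
    have hn0 : (0 : ℝ) < n := by exact_mod_cast hn.1
    have e1 : ∑ q ∈ n.divisorsAntidiagonal, f q.1 * ((q.1 : ℝ) ^ (κ - 1) * (q.2 : ℝ) ^ (κ - 1)) =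
        (∑ q ∈ n.divisorsAntidiagonal, f q.1) * (n : ℝ) ^ (κ - 1) := by
      rw [Finset.sum_mul]
      refine Finset.sum_congr rfl fun q hq => ?_
      rw [Nat.mem_divisorsAntidiagonal] at hq
      rw [← Real.mul_rpow (by positivity) (by positivity), ← Nat.cast_mul, hq.1]
    have e2 : ∑ q ∈ n.divisorsAntidiagonal, f q.1 * (1 / (q.1 : ℝ) * (1 / (q.2 : ℝ))) =
        (∑ q ∈ n.divisorsAntidiagonal, f q.1) * (1 / (n : ℝ)) := by
      rw [Finset.sum_mul]
      refine Finset.sum_congr rfl fun q hq => ?_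
      rw [Nat.mem_divisorsAntidiagonal] at hq
      rw [← hq.1]; push_cast; rw [one_div_mul_one_div]
    rw [e1, e2]
    have hr := hf.r_nonneg n
    have e3 : (n : ℝ) ^ (κ - 1) ≤ (x : ℝ) ^ κ * (1 / (n : ℝ)) := by
      rw [Real.rpow_sub hn0, Real.rpow_one, mul_one_div]
      have : (n : ℝ) ≤ x := by exact_mod_cast hn.2
      gcongr
    calc _ ≤ (∑ q ∈ n.divisorsAntidiagonal, f q.1) * ((x : ℝ) ^ κ * (1 / (n : ℝ))) := by gcongr
      _ = _ := by ring
  have hmain : (x : ℝ) ^ κ / κ * S + C * (∑ n ∈ Finset.Ioc 0 x, f n * (n : ℝ) ^ (κ - 1)) -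
      2 * (x : ℝ) ^ κ ≤ ∑ n ∈ Finset.Ioc 0 x, ∑ q ∈ n.divisorsAntidiagonal, f q.1 * ((q.1 : ℝ) ^ (κ - 1) * (q.2 : ℝ) ^ (κ - 1)) := by
    rw [hQ]
    have e4 : 2 * (x : ℝ) ^ κ = ∑ n ∈ Finset.Ioc 0 x, 2 * (x : ℝ) ^ (κ - 1) := by
      rw [Finset.sum_const, Nat.card_Ioc, Real.rpow_sub hx0, Real.rpow_one]
      simp; field_simp
    rw [e4, hS, Finset.mul_sum, Finset.mul_sum, ← Finset.sum_add_distrib, ← Finset.sum_sub_distrib]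
    refine Finset.sum_le_sum fun m hm => ?_
    rw [Finset.mem_Ioc] at hm
    have hm0 : (0 : ℝ) < m := by exact_mod_cast hm.1
    have h1 := hC2 ((x : ℝ) / m) (by rw [le_div_iff₀ hm0]; have : (m : ℝ) ≤ x := by exact_mod_cast hm.2
                                     linarith)
    rw [Nat.floor_div_eq_div] at h1
    have e5 : ∑ k ∈ Finset.Ioc 0 (x / m), f m * ((m : ℝ) ^ (κ - 1) * (k : ℝ) ^ (κ - 1)) =
        f m * (m : ℝ) ^ (κ - 1) * ∑ k ∈ Finset.Ioc 0 (x / m), (k : ℝ) ^ (κ - 1) := by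
      rw [Finset.mul_sum]; refine Finset.sum_congr rfl fun k _ => by ring
    rw [e5]
    set h := ∑ k ∈ Finset.Ioc 0 (x / m), (k : ℝ) ^ (κ - 1) with hh
    have e6 : (x : ℝ) ^ κ / κ * (f m / m) = f m * (m : ℝ) ^ (κ - 1) * (((x : ℝ) / m) ^ κ / κ) := by
      rw [Real.div_rpow hx0.le hm0.le, Real.rpow_sub hm0, Real.rpow_one]
      have : (m : ℝ) ^ κ ≠ 0 := (Real.rpow_pos_of_pos hm0 κ).ne'
      field_simp
    have e7 : (x : ℝ) ^ (κ - 1) = (m : ℝ) ^ (κ - 1) * ((x : ℝ) / m) ^ (κ - 1) := by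
      rw [← Real.mul_rpow hm0.le (by positivity)]; congr 1; field_simp
    have hp : 0 ≤ (m : ℝ) ^ (κ - 1) := by positivity
    have h2 : |f m * (m : ℝ) ^ (κ - 1) * (h - ((x : ℝ) / m) ^ κ / κ - C)| ≤ (m : ℝ) ^ (κ - 1) * (2 * ((x : ℝ) / m) ^ (κ - 1)) := by
      rw [abs_mul, abs_mul, abs_of_nonneg hp]
      have := hf.abs_le_one m
      have h3 : |f m| * (m : ℝ) ^ (κ - 1) ≤ (m : ℝ) ^ (κ - 1) := by nlinarith
      exact mul_le_mul h3 h1 (abs_nonneg _) hp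
    rw [e6, e7]
    have := (abs_le.1 h2).1
    nlinarith
  have hxκ : 0 < (x : ℝ) ^ κ := Real.rpow_pos_of_pos hx0 κ
  have hCZ : |C * (∑ n ∈ Finset.Ioc 0 x, f n * (n : ℝ) ^ (κ - 1))| ≤ 1 / κ * (2 * B * ((x : ℝ) ^ κ / x)) := by
    rw [abs_mul]
    rw [Real.rpow_sub hx0, Real.rpow_one] at hZ
    exact mul_le_mul hC hZ (abs_nonneg _) (by positivity)
  have h9 := (abs_le.1 hCZ).1
  have h10 : (x : ℝ) ^ κ / κ * S ≤ (x : ℝ) ^ κ * R + 1 / κ * (2 * B * ((x : ℝ) ^ κ / x)) + 2 * (x : ℝ) ^ κ := by linarith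
  have h11 : (x : ℝ) ^ κ / κ * S = ((x : ℝ) ^ κ / κ) * S := rfl
  have h12 : (x : ℝ) ^ κ * R + 1 / κ * (2 * B * ((x : ℝ) ^ κ / x)) + 2 * (x : ℝ) ^ κ =
    ((x : ℝ) ^ κ / κ) * (κ * R + 2 * κ + 2 * B / x) := by field_simp; ring
  rw [h12] at h10
  exact le_of_mul_le_mul_left h10 (by positivity)

/-! ### A Mertens type theorem: convergence of `∑ f(p)/p` -/

theorem log_div_anti (n : ℕ) (hn : 3 ≤ n) :
    Real.log ((n + 1 : ℕ) : ℝ) / ((n + 1 : ℕ) : ℝ) ≤ Real.log n / n := by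
  have h3 : Real.exp 1 ≤ n := by
    have : (3 : ℝ) ≤ n := by exact_mod_cast hn
    linarith [Real.exp_one_lt_d9]
  refine Real.log_div_self_antitoneOn h3 ?_ (by push_cast; linarith)
  show Real.exp 1 ≤ _
  push_cast; linarith

theorem RC.logsum_bounded {f : ℕ → ℝ} (B : ℝ)
    (hB : ∀ n, |∑ k ∈ Finset.Ioc 0 n, f k| ≤ B) :
    ∃ C, ∀ N, |∑ n ∈ Finset.Ioc 0 N, f n * (Real.log n / n)| ≤ C := by
  have hlim : Tendsto (fun n : ℕ => Real.log n / n) atTop (nhds 0) := by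
    have := (Real.isLittleO_log_id_atTop.tendsto_div_nhds_zero).comp tendsto_natCast_atTop_atTop
    simpa [Function.comp_def] using this
  obtain ⟨l, hl, -⟩ := dirichlet_test f (fun n => Real.log n / n) B 3 hB
    (fun n _ => by positivity) log_div_anti hlim
  obtain ⟨C, hC⟩ := (Metric.isBounded_range_of_tendsto _ hl).exists_norm_le
  exact ⟨C, fun N => hC _ ⟨N, rfl⟩⟩

theorem RC.exists_one {f : ℕ → ℝ} (B : ℝ)
    (hB : ∀ n, |∑ k ∈ Finset.Ioc 0 n, f k| ≤ B) :
    ∃ l : ℝ, Tendsto (fun N => ∑ n ∈ Finset.Ioc 0 N, f n / n) atTop (nhds l) ∧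
      ∀ N : ℕ, |l - ∑ n ∈ Finset.Ioc 0 N, f n / n| ≤ 2 * B / (N + 1) := by
  obtain ⟨l, hl, hl2⟩ := dirichlet_test f (fun n => 1 / (n : ℝ)) B 1 hB
    (fun n _ => by positivity)
    (fun n hn => by
      have : (0 : ℝ) < n := by exact_mod_cast hn
      apply one_div_le_one_div_of_le this; push_cast; linarith)
    tendsto_one_div_atTop_nhds_zero_nat
  simp only [mul_one_div] at hl hl2
  refine ⟨l, hl, fun N => ?_⟩
  have := hl2 N (by omega)
  push_cast at this
  exact this

theorem RC.mangoldt_bounded {f : ℕ → ℝ} (hf : RC f) (B : ℝ)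
    (hB : ∀ n, |∑ k ∈ Finset.Ioc 0 n, f k| ≤ B) (l : ℝ)
    (hl : ∀ N : ℕ, |l - ∑ n ∈ Finset.Ioc 0 N, f n / n| ≤ 2 * B / (N + 1)) (hl0 : l ≠ 0) :
    ∃ C, ∀ N, |∑ n ∈ Finset.Ioc 0 N, f n * (ArithmeticFunction.vonMangoldt n / n)| ≤ C := by
  obtain ⟨C, hC⟩ := RC.logsum_bounded B hB
  have hB0 : 0 ≤ B := (abs_nonneg _).trans (hB 0)
  refine ⟨(C + 2 * B * (Real.log 4 + 4)) / |l|, fun x => ?_⟩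
  have hC0 : 0 ≤ C := (abs_nonneg _).trans (hC 0)
  rcases Nat.eq_zero_or_pos x with rfl | hx
  · simp; positivity
  have hx0 : (0 : ℝ) < x := by exact_mod_cast hx
  rw [le_div_iff₀ (abs_pos.2 hl0), ← abs_mul]
  have hyp := sum_divisors_hyperbola (fun m k => (f m * (ArithmeticFunction.vonMangoldt m / m)) * (f k / k)) x
  have e1 : ∑ n ∈ Finset.Ioc 0 x, ∑ q ∈ n.divisorsAntidiagonal, (f q.1 * (ArithmeticFunction.vonMangoldt q.1 / q.1)) * (f q.2 / q.2)
      = ∑ n ∈ Finset.Ioc 0 x, f n * (Real.log n / n) := by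
    refine Finset.sum_congr rfl fun n hn => ?_
    have : Real.log n = ∑ q ∈ n.divisorsAntidiagonal, ArithmeticFunction.vonMangoldt q.1 := by
      rw [← ArithmeticFunction.vonMangoldt_sum, Nat.sum_divisorsAntidiagonal (f := fun i _ => ArithmeticFunction.vonMangoldt i)]
    rw [this, Finset.sum_div, Finset.mul_sum]
    refine Finset.sum_congr rfl fun q hq => ?_
    rw [Nat.mem_divisorsAntidiagonal] at hq
    rw [← hq.1, hf.mul]
    push_cast
    have h1 : (q.1 : ℝ) ≠ 0 := by
      have := hq.2; rw [← hq.1] at this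
      exact_mod_cast left_ne_zero_of_mul this
    have h2 : (q.2 : ℝ) ≠ 0 := by
      have := hq.2; rw [← hq.1] at this
      exact_mod_cast right_ne_zero_of_mul this
    field_simp
  rw [e1] at hyp
  simp only [← Finset.mul_sum] at hyp
  have h2 : |(∑ n ∈ Finset.Ioc 0 x, f n * (ArithmeticFunction.vonMangoldt n / n)) * l -
      ∑ m ∈ Finset.Ioc 0 x, f m * (ArithmeticFunction.vonMangoldt m / m) * ∑ k ∈ Finset.Ioc 0 (x / m), f k / k| ≤
      2 * B * (Real.log 4 + 4) := by
    rw [Finset.sum_mul, ← Finset.sum_sub_distrib]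
    calc _ ≤ ∑ m ∈ Finset.Ioc 0 x, 2 * B / x * ArithmeticFunction.vonMangoldt m := by
          refine (Finset.abs_sum_le_sum_abs _ _).trans (Finset.sum_le_sum fun m hm => ?_)
          rw [Finset.mem_Ioc] at hm
          have hm0 : (0 : ℝ) < m := by exact_mod_cast hm.1
          rw [← mul_sub, abs_mul, abs_mul]
          have h3 := hl (x / m)
          have h4 : 2 * B / (((x / m : ℕ) : ℝ) + 1) ≤ 2 * B * m / x := by
            have h5 : (x : ℝ) / m < ((x / m : ℕ) : ℝ) + 1 := by
              rw [← Nat.floor_div_eq_div (K := ℝ)]; exact Nat.lt_floor_add_one _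
            rw [div_lt_iff₀ hm0] at h5
            rw [div_le_div_iff₀ (by positivity) hx0]
            nlinarith
          have hv : 0 ≤ ArithmeticFunction.vonMangoldt m := ArithmeticFunction.vonMangoldt_nonneg
          rw [abs_of_nonneg (a := ArithmeticFunction.vonMangoldt m / (m : ℝ)) (by positivity)]
          calc _ ≤ 1 * (ArithmeticFunction.vonMangoldt m / m) * (2 * B * m / x) := by
                gcongr
                · exact hf.abs_le_one m
                · exact h3.trans h4
            _ = _ := by field_simp
      _ ≤ 2 * B / x * ((Real.log 4 + 4) * x) := by
          rw [← Finset.mul_sum]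
          have := Chebyshev.psi_le_const_mul_self (x := (x : ℝ)) hx0.le
          rw [Chebyshev.psi, Nat.floor_natCast] at this
          gcongr
      _ = _ := by field_simp
  rw [← hyp] at h2
  have h3 := abs_le.1 (hC x)
  have h4 := abs_le.1 h2
  rw [abs_le]; constructor <;> linarith

theorem RC.primelog_bounded {f : ℕ → ℝ} (hf : RC f) (C : ℝ)
    (hC : ∀ N, |∑ n ∈ Finset.Ioc 0 N, f n * (ArithmeticFunction.vonMangoldt n / n)| ≤ C) :
    ∃ C', ∀ N, |∑ n ∈ Finset.Ioc 0 N, (if n.Prime then f n * (Real.log n / n) else 0)| ≤ C' := by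
  have hs := ArithmeticFunction.vonMangoldt.summable_residueClass_non_primes_div (q := 1) 0
  have hr : ∀ n : ℕ, ArithmeticFunction.vonMangoldt.residueClass (0 : ZMod 1) n = ArithmeticFunction.vonMangoldt n := by
    intro n
    rw [ArithmeticFunction.vonMangoldt.residueClass]
    simp [Subsingleton.elim (n : ZMod 1) 0]
  simp only [hr] at hs
  refine ⟨C + ∑' n : ℕ, (if n.Prime then 0 else ArithmeticFunction.vonMangoldt n) / n, fun N => ?_⟩
  have hnn : ∀ n : ℕ, 0 ≤ (if n.Prime then 0 else ArithmeticFunction.vonMangoldt n) / (n : ℝ) := by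
    intro n
    have hv : 0 ≤ ArithmeticFunction.vonMangoldt n := ArithmeticFunction.vonMangoldt_nonneg
    split_ifs <;> positivity
  have e : ∑ n ∈ Finset.Ioc 0 N, (if n.Prime then f n * (Real.log n / n) else 0) =
      ∑ n ∈ Finset.Ioc 0 N, f n * (ArithmeticFunction.vonMangoldt n / n) -
      ∑ n ∈ Finset.Ioc 0 N, f n * ((if n.Prime then 0 else ArithmeticFunction.vonMangoldt n) / n) := by
    rw [← Finset.sum_sub_distrib]
    refine Finset.sum_congr rfl fun n _ => ?_
    split_ifs with h
    · rw [ArithmeticFunction.vonMangoldt_apply_prime h]; simp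
    · simp
  rw [e]
  refine (abs_sub _ _).trans (add_le_add (hC N) ?_)
  refine (Finset.abs_sum_le_sum_abs _ _).trans (le_trans ?_ (hs.sum_le_tsum (Finset.Ioc 0 N) fun n _ => hnn n))
  refine Finset.sum_le_sum fun n _ => ?_
  rw [abs_mul, abs_of_nonneg (hnn n)]
  have := hf.abs_le_one n
  nlinarith [hnn n]

theorem RC.prime_conv {f : ℕ → ℝ} (hf : RC f) (B : ℝ)
    (hB : ∀ n, |∑ k ∈ Finset.Ioc 0 n, f k| ≤ B) (l : ℝ)
    (hl : ∀ N : ℕ, |l - ∑ n ∈ Finset.Ioc 0 N, f n / n| ≤ 2 * B / (N + 1)) (hl0 : l ≠ 0) :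
    ∃ L : ℝ, Tendsto (fun N => ∑ n ∈ Finset.Ioc 0 N, (if n.Prime then f n / n else 0)) atTop (nhds L) := by
  obtain ⟨C, hC⟩ := hf.mangoldt_bounded B hB l hl hl0
  obtain ⟨C', hC'⟩ := hf.primelog_bounded C hC
  obtain ⟨L, hL, -⟩ := dirichlet_test (fun n => if n.Prime then f n * (Real.log n / n) else 0)
    (fun n => (Real.log n)⁻¹) C' 2 hC' (fun n _ => by positivity)
    (fun n hn => by
      have h1 : (1 : ℝ) < n := by exact_mod_cast hn
      have h2 := Real.log_pos h1
      apply inv_anti₀ h2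
      apply Real.log_le_log (by linarith)
      push_cast; linarith)
    (tendsto_inv_atTop_zero.comp (Real.tendsto_log_atTop.comp tendsto_natCast_atTop_atTop))
  refine ⟨L, hL.congr fun N => Finset.sum_congr rfl fun n _ => ?_⟩
  split_ifs with h
  · have h1 : (1 : ℝ) < n := by exact_mod_cast h.one_lt
    have := (Real.log_pos h1).ne'
    field_simp
  · simp

theorem one_sub_inv_le_exp (u : ℝ) (hu : |u| ≤ 1 / 2) : (1 - u)⁻¹ ≤ Real.exp (u + 2 * u ^ 2) := by
  have h := abs_le.1 hu
  have h1 := Real.add_one_le_exp (u + 2 * u ^ 2)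
  rw [inv_le_iff_one_le_mul₀ (by linarith)]
  have h2 : 1 ≤ (u + 2 * u ^ 2 + 1) * (1 - u) := by nlinarith [sq_nonneg u, mul_nonneg (sq_nonneg u) (by linarith : 0 ≤ 1 - 2 * u)]
  exact h2.trans (mul_le_mul_of_nonneg_right h1 (by linarith))

theorem sum_inv_sq_le (N : ℕ) : ∑ n ∈ Finset.Ioc 0 N, 1 / (n : ℝ) ^ 2 ≤ 2 := by
  have : ∀ N : ℕ, ∑ n ∈ Finset.Ioc 0 (N + 1), 1 / (n : ℝ) ^ 2 ≤ 2 - 1 / ((N : ℝ) + 1) := by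
    intro N
    induction N with
    | zero => simp; norm_num
    | succ N ih =>
      rw [Finset.sum_Ioc_succ_top (by omega)]
      push_cast at ih ⊢
      have h : 1 / ((N : ℝ) + 1 + 1) ^ 2 ≤ 1 / ((N : ℝ) + 1) - 1 / ((N : ℝ) + 1 + 1) := by
        rw [div_sub_div _ _ (by positivity) (by positivity), div_le_div_iff₀ (by positivity) (by positivity)]
        nlinarith [(Nat.cast_nonneg N : (0 : ℝ) ≤ N)]
      linarith
  rcases N with _ | N
  · simp
  · refine (this N).trans ?_
    have : (0 : ℝ) ≤ 1 / ((N : ℝ) + 1) := by positivity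
    linarith

theorem RC.euler_le {f : ℕ → ℝ} (hf : RC f) (δ : ℝ) (hδ : 0 < δ) (N0 : ℕ) (b : ℝ)
    (hb : ∀ N, N0 ≤ N → ∑ n ∈ Finset.Ioc 0 N, (if n.Prime then f n / n else 0) * (n : ℝ) ^ (-δ) ≤ b)
    (c : ℝ) (hc : ∀ N, N0 ≤ N → c ≤ ∑ n ∈ Finset.Ioc 0 N, f n / n * (n : ℝ) ^ (-δ)) :
    c ≤ Real.exp (b + 4) := by
  set F : ℕ →*₀ ℝ :=
    { toFun := fun n => f n / n * (n : ℝ) ^ (-δ)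
      map_zero' := by simp
      map_one' := by simp [hf.one]
      map_mul' := fun m n => by
        rw [hf.mul]; push_cast
        rw [Real.mul_rpow (by positivity) (by positivity)]
        ring } with hF
  have hFa : ∀ n, F n = f n / n * (n : ℝ) ^ (-δ) := fun n => rfl
  have habs : ∀ n : ℕ, ‖F n‖ ≤ 1 / (n : ℝ) ^ (1 + δ) := by
    intro n
    rcases Nat.eq_zero_or_pos n with rfl | hn
    · simp; positivity
    have hn0 : (0 : ℝ) < n := by exact_mod_cast hn
    rw [hFa, Real.norm_eq_abs, abs_mul, abs_div, abs_of_pos hn0, abs_of_nonneg (by positivity : (0 : ℝ) ≤ (n : ℝ) ^ (-δ)),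
      Real.rpow_add hn0, Real.rpow_one, Real.rpow_neg hn0.le]
    have := hf.abs_le_one n
    have h2 : 0 < (n : ℝ) ^ δ := Real.rpow_pos_of_pos hn0 _
    calc _ ≤ 1 / (n : ℝ) * ((n : ℝ) ^ δ)⁻¹ := by gcongr
      _ = _ := by field_simp
  have hsum : Summable (‖F ·‖) :=
    Summable.of_nonneg_of_le (fun _ => norm_nonneg _) habs (Real.summable_one_div_nat_rpow.2 (by linarith))
  have hE := EulerProduct.eulerProduct_completely_multiplicative hsum
  have hS : Tendsto (fun N => ∑ n ∈ Finset.Ioc 0 N, F n) atTop (nhds (∑' n, F n)) := by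
    have := (hsum.of_norm.hasSum.tendsto_sum_nat).comp (tendsto_add_atTop_nat 1)
    refine this.congr fun N => ?_
    simp only [Function.comp]
    rw [Finset.sum_range_succ', map_zero, add_zero, Finset.range_eq_Ico, Finset.sum_Ico_add' (fun n => F n) 0 N 1]
    refine Finset.sum_congr ?_ fun _ _ => rfl
    ext a; simp only [Finset.mem_Ico, Finset.mem_Ioc]; omega
  have h1 : c ≤ ∑' n, F n := by
    refine ge_of_tendsto hS ?_
    filter_upwards [eventually_ge_atTop N0] with N hN
    exact hc N hN
  have h2 : ∑' n, F n ≤ Real.exp (b + 4) := by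
    refine le_of_tendsto (hE.comp (tendsto_add_atTop_nat 1)) ?_
    filter_upwards [eventually_ge_atTop N0] with N hN
    simp only [Function.comp]
    have hset : Nat.primesBelow (N + 1) = (Finset.Ioc 0 N).filter Nat.Prime := by
      ext p; simp only [Nat.mem_primesBelow, Finset.mem_filter, Finset.mem_Ioc]
      constructor
      · rintro ⟨h, hp⟩; exact ⟨⟨hp.pos, by omega⟩, hp⟩
      · rintro ⟨h, hp⟩; exact ⟨by omega, hp⟩
    have hF1 : ∀ p : ℕ, p.Prime → |F p| ≤ 1 / p := by
      intro p hp
      have hp0 : (0 : ℝ) < p := by exact_mod_cast hp.pos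
      have hp1 : (1 : ℝ) ≤ p := by exact_mod_cast hp.one_lt.le
      rw [← Real.norm_eq_abs]
      refine (habs p).trans ?_
      apply one_div_le_one_div_of_le hp0
      exact Real.self_le_rpow_of_one_le hp1 (by linarith)
    calc ∏ p ∈ Nat.primesBelow (N + 1), (1 - F p)⁻¹
        ≤ ∏ p ∈ Nat.primesBelow (N + 1), Real.exp (F p + 2 * F p ^ 2) := by
          refine Finset.prod_le_prod (fun p hp => ?_) (fun p hp => ?_)
          all_goals
            have hp' := (Nat.mem_primesBelow.1 hp).2
            have h3 := hF1 p hp'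
            have h4 : (1 : ℝ) / p ≤ 1 / 2 := by
              apply one_div_le_one_div_of_le (by norm_num); exact_mod_cast hp'.two_le
          · have := (abs_le.1 (h3.trans h4)).2
            apply inv_nonneg.2; linarith
          · exact one_sub_inv_le_exp _ (h3.trans h4)
      _ = Real.exp (∑ p ∈ Nat.primesBelow (N + 1), F p + 2 * ∑ p ∈ Nat.primesBelow (N + 1), F p ^ 2) := by
          rw [← Real.exp_sum, Finset.sum_add_distrib, Finset.mul_sum]
      _ ≤ Real.exp (b + 4) := by
          apply Real.exp_le_exp.2
          have h5 : ∑ p ∈ Nat.primesBelow (N + 1), F p ≤ b := by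
            rw [hset, Finset.sum_filter]
            refine le_trans (le_of_eq ?_) (hb N hN)
            refine Finset.sum_congr rfl fun n _ => ?_
            split_ifs <;> simp [hFa]
          have h6 : ∑ p ∈ Nat.primesBelow (N + 1), F p ^ 2 ≤ 2 := by
            refine le_trans ?_ (sum_inv_sq_le N)
            calc _ ≤ ∑ p ∈ Nat.primesBelow (N + 1), 1 / (p : ℝ) ^ 2 := by
                  refine Finset.sum_le_sum fun p hp => ?_
                  have := hF1 p (Nat.mem_primesBelow.1 hp).2
                  rw [← sq_abs, ← one_div_pow]
                  gcongr
              _ ≤ _ := by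
                  rw [hset]
                  exact Finset.sum_le_sum_of_subset_of_nonneg (Finset.filter_subset _ _) fun _ _ _ => by positivity
          linarith
  exact h1.trans h2

theorem RC.curly {f : ℕ → ℝ} (hf : RC f) (B : ℝ)
    (hB : ∀ n, |∑ k ∈ Finset.Ioc 0 n, f k| ≤ B) (l : ℝ)
    (hlt : Tendsto (fun N => ∑ n ∈ Finset.Ioc 0 N, f n / n) atTop (nhds l))
    (hl : ∀ N : ℕ, |l - ∑ n ∈ Finset.Ioc 0 N, f n / n| ≤ 2 * B / (N + 1)) (hl0 : 0 < l) :
    ∃ L : ℝ, Tendsto (fun y : ℕ => ∑ p ∈ (Finset.range y).filter Nat.Prime, f p / p) atTop (nhds L) ∧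
      Real.log l - 6 ≤ L := by
  obtain ⟨L, hL⟩ := hf.prime_conv B hB l hl hl0.ne'
  refine ⟨L, ?_, ?_⟩
  · rw [← tendsto_add_atTop_iff_nat 1]
    refine hL.congr fun N => ?_
    rw [← Finset.sum_filter]
    refine Finset.sum_congr ?_ fun _ _ => rfl
    ext p; simp only [Finset.mem_filter, Finset.mem_Ioc, Finset.mem_range]
    constructor
    · rintro ⟨h, hp⟩; exact ⟨by omega, hp⟩
    · rintro ⟨h, hp⟩; exact ⟨⟨hp.pos, by omega⟩, hp⟩
  · obtain ⟨M1, h1⟩ := abel_limit _ L hL 1 one_pos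
    obtain ⟨M2, h2⟩ := abel_limit _ l hlt (l / 2) (by linarith)
    have h3 : ∀ᶠ δ : ℝ in nhdsWithin 0 (Set.Ioi 0), 0 < δ := self_mem_nhdsWithin
    obtain ⟨δ, ⟨hδ1, hδ2⟩, hδ⟩ := ((h1.and h2).and h3).exists
    have := hf.euler_le δ hδ (max M1 M2) (L + 1)
      (fun N hN => by have := (abs_le.1 (hδ1 N (le_of_max_le_left hN))).2; linarith) (l / 2)
      (fun N hN => by have := (abs_le.1 (hδ2 N (le_of_max_le_right hN))).1; linarith)
    have h4 := Real.log_le_log (by linarith) this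
    rw [Real.log_exp, Real.log_div hl0.ne' (by norm_num)] at h4
    have := Real.log_two_lt_d9
    linarith

/-! ### Part D: identification of the L-function -/

theorem abel_range (a b : ℕ → ℂ) (N : ℕ) :
    ∑ n ∈ Finset.range N, a n * b n = (∑ n ∈ Finset.range N, a n) * b N +
      ∑ n ∈ Finset.range N, (∑ i ∈ Finset.range (n+1), a i) * (b n - b (n+1)) := by
  induction N with
  | zero => simp
  | succ N ih =>
    rw [Finset.sum_range_succ, ih, Finset.sum_range_succ _ N, Finset.sum_range_succ _ N]
    rw [Finset.sum_range_succ a N]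
    ring

theorem cpow_sub_bound (s : ℂ) (hs : 0 < s.re) (x : ℝ) (hx : 1 ≤ x) :
    ‖((x + 1 : ℝ) : ℂ) ^ (-s) - (x : ℂ) ^ (-s)‖ ≤ ‖s‖ * x ^ (-s.re - 1) := by
  have key : ∀ t ∈ Set.Icc x (x+1), HasDerivWithinAt (fun t : ℝ => (t : ℂ) ^ (-s))
      (-s * (t : ℂ) ^ (-s - 1)) (Set.Icc x (x+1)) t := by
    intro t ht
    have ht0 : t ≠ 0 := by linarith [ht.1]
    have hs0 : -s ≠ 0 := by
      intro h
      have : s = 0 := by simpa using h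
      simp [this] at hs
    exact (hasDerivAt_ofReal_cpow_const ht0 hs0).hasDerivWithinAt
  have h := norm_image_sub_le_of_norm_deriv_le_segment' (C := ‖s‖ * x ^ (-s.re - 1)) key ?_ (x+1) (by constructor <;> linarith)
  · simpa using h
  · intro t ht
    have htp : 0 < t := by linarith [ht.1]
    rw [norm_mul, norm_neg, Complex.norm_cpow_eq_rpow_re_of_pos htp]
    simp only [Complex.sub_re, Complex.neg_re, Complex.one_re]
    apply mul_le_mul_of_nonneg_left _ (norm_nonneg s)
    have hx0 : 0 < x := by linarith
    have he : -s.re - 1 ≤ 0 := by linarith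
    exact Real.rpow_le_rpow_of_nonpos hx0 ht.1 he

noncomputable def gterm (a : ℕ → ℂ) (n : ℕ) (s : ℂ) : ℂ :=
  (∑ i ∈ Finset.range (n+1), a i) * (((n : ℝ) + 1 : ℝ) ^ (-s) - (((n : ℝ) + 1 + 1 : ℝ) : ℂ) ^ (-s))

theorem gterm_bound (a : ℕ → ℂ) (B : ℝ) (hB : ∀ n, ‖∑ i ∈ Finset.range n, a i‖ ≤ B) (n : ℕ) (s : ℂ)
    (σ R : ℝ) (hσ : 0 < σ) (hs : σ < s.re) (hR : ‖s‖ ≤ R) :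
    ‖gterm a n s‖ ≤ B * (R * ((n : ℝ) + 1) ^ (-σ - 1)) := by
  unfold gterm
  have hB0 : 0 ≤ B := le_trans (norm_nonneg _) (hB 0)
  have hR0 : 0 ≤ R := le_trans (norm_nonneg _) hR
  rw [norm_mul]
  apply mul_le_mul (hB _) _ (norm_nonneg _) hB0
  rw [norm_sub_rev]
  refine (cpow_sub_bound s (by linarith) ((n:ℝ)+1) (by linarith [Nat.cast_nonneg (α := ℝ) n])).trans ?_
  apply mul_le_mul hR _ (by positivity) hR0
  apply Real.rpow_le_rpow_of_exponent_le
  · linarith [Nat.cast_nonneg (α := ℝ) n]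
  · linarith

theorem gsummable (B R σ : ℝ) (hσ : 0 < σ) :
    Summable (fun n : ℕ => B * (R * ((n : ℝ) + 1) ^ (-σ - 1))) := by
  apply Summable.mul_left
  apply Summable.mul_left
  have h := (Real.summable_nat_rpow (p := -σ - 1)).2 (by linarith)
  have h2 := (summable_nat_add_iff 1).2 h
  simpa using h2

theorem gpartial (a : ℕ → ℂ) (B : ℝ) (hB : ∀ n, ‖∑ i ∈ Finset.range n, a i‖ ≤ B) (s : ℂ)
    (hs : 0 < s.re) :
    Tendsto (fun N => ∑ n ∈ Finset.range N, a n * (((n : ℝ) + 1 : ℝ) : ℂ) ^ (-s)) atTop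
      (nhds (∑' n, gterm a n s)) := by
  have hsum : Summable (fun n => gterm a n s) := by
    apply Summable.of_norm_bounded (gsummable B ‖s‖ (s.re/2) (by linarith))
    intro n
    exact gterm_bound a B hB n s (s.re/2) ‖s‖ (by linarith) (by linarith) le_rfl
  have h1 := hsum.hasSum.tendsto_sum_nat
  have h2 : Tendsto (fun N : ℕ => (∑ n ∈ Finset.range N, a n) * (((N : ℝ) + 1 : ℝ) : ℂ) ^ (-s)) atTop (nhds 0) := by
    have h3 : Tendsto (fun N : ℕ => B * ((N:ℝ) + 1) ^ (-s.re)) atTop (nhds 0) := by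
      have h4 : Tendsto (fun N : ℕ => (N:ℝ) + 1) atTop atTop :=
        tendsto_atTop_add_const_right _ _ tendsto_natCast_atTop_atTop
      have := ((tendsto_rpow_neg_atTop hs).comp h4).const_mul B
      simpa using this
    apply squeeze_zero_norm _ h3
    intro N
    rw [norm_mul, Complex.norm_cpow_eq_rpow_re_of_pos (by positivity)]
    simp only [Complex.neg_re]
    gcongr
    exact hB N
  have h3 := h2.add h1
  rw [zero_add] at h3
  refine h3.congr ?_
  intro N
  rw [abel_range a (fun n => (((n : ℝ) + 1 : ℝ) : ℂ) ^ (-s))]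
  congr 1
  apply Finset.sum_congr rfl
  intro n _
  simp [gterm]

theorem LFunction_eq_limit {d : ℕ} [NeZero d] (χ : DirichletCharacter ℂ d) (hχ : χ ≠ 1) (f : ℕ → ℝ)
    (hf : ∀ n : ℕ, χ n = (f n : ℂ)) (B : ℝ) (hB : ∀ n, |∑ k ∈ Finset.Ioc 0 n, f k| ≤ B)
    (β : ℝ) (hβ : 0 < β) (hβ1 : β ≤ 1) (l : ℝ)
    (hl : Tendsto (fun N => ∑ n ∈ Finset.Ioc 0 N, f n * (n:ℝ) ^ (-β)) atTop (nhds l)) :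
    DirichletCharacter.LFunction χ β = l := by
  set a : ℕ → ℂ := fun n => (f (n+1) : ℂ) with ha
  have conv : ∀ (N : ℕ) (g : ℕ → ℂ), ∑ n ∈ Finset.Ioc 0 N, g n = ∑ n ∈ Finset.range N, g (n+1) := by
    intro N g
    induction N with
    | zero => simp
    | succ N ih => rw [Finset.sum_Ioc_succ_top (by omega), ih, Finset.sum_range_succ]
  have hB' : ∀ n, ‖∑ i ∈ Finset.range n, a i‖ ≤ B := by
    intro n
    have h1 : ∑ i ∈ Finset.range n, a i = ((∑ k ∈ Finset.Ioc 0 n, f k : ℝ) : ℂ) := by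
      push_cast
      rw [conv]
    rw [h1, Complex.norm_real]
    exact hB n
  set U : Set ℂ := {s | β / 2 < s.re} ∩ Metric.ball 0 4 with hU
  have hUo : IsOpen U := (isOpen_lt continuous_const Complex.continuous_re).inter Metric.isOpen_ball
  have hUc : Convex ℝ U := (convex_halfSpace_re_gt _).inter (convex_ball _ _)
  have hgd : DifferentiableOn ℂ (fun s => ∑' n, gterm a n s) U := by
    refine Complex.differentiableOn_tsum_of_summable_norm (gsummable B 4 (β/2) (by linarith)) ?_ hUo ?_
    rotate_left
    · intro n s hs
      refine gterm_bound a B hB' n s (β/2) 4 (by linarith) hs.1 ?_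
      have := hs.2
      simp at this
      exact this.le
    · intro n
      unfold gterm
      have h1 : (((n:ℝ)+1 : ℝ) : ℂ) ≠ 0 := by
        norm_cast
      have h2 : (((n:ℝ)+1+1 : ℝ) : ℂ) ≠ 0 := by
        norm_cast
      intro s _
      apply DifferentiableAt.differentiableWithinAt
      apply DifferentiableAt.const_mul
      apply DifferentiableAt.sub
      · exact (differentiableAt_id.neg).const_cpow (Or.inl h1)
      · exact (differentiableAt_id.neg).const_cpow (Or.inl h2)
  have heqLS : ∀ s : ℂ, 1 < s.re → DirichletCharacter.LFunction χ s = ∑' n, gterm a n s := by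
    intro s hs
    rw [DirichletCharacter.LFunction_eq_LSeries χ hs]
    have h1 := (DirichletCharacter.LSeriesSummable_of_one_lt_re χ hs).hasSum
    have h2 := (hasSum_nat_add_iff' 1).2 h1
    have h3 := h2.tendsto_sum_nat
    have h4 := gpartial a B hB' s (by linarith)
    refine tendsto_nhds_unique ?_ h4
    have h5 : LSeries (fun n => χ n) s = ∑' n, LSeries.term (fun n => χ n) s n - ∑ i ∈ Finset.range 1, LSeries.term (fun n => χ n) s i := by
      simp [LSeries]
    rw [h5]
    refine h3.congr ?_
    intro N
    apply Finset.sum_congr rfl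
    intro n _
    rw [LSeries.term_of_ne_zero (by omega), ha]
    simp only
    rw [hf, Complex.cpow_neg, div_eq_mul_inv]
    push_cast
    rfl
  have hLd := DirichletCharacter.differentiable_LFunction hχ
  have hA1 : AnalyticOnNhd ℂ (DirichletCharacter.LFunction χ) U := hLd.differentiableOn.analyticOnNhd hUo
  have hA2 : AnalyticOnNhd ℂ (fun s => ∑' n, gterm a n s) U := hgd.analyticOnNhd hUo
  have h2U : (2:ℂ) ∈ U := by
    constructor
    · simp; linarith
    · simp; norm_num
  have hev : DirichletCharacter.LFunction χ =ᶠ[nhds 2] (fun s => ∑' n, gterm a n s) := by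
    have : {s : ℂ | 1 < s.re} ∈ nhds (2:ℂ) := (isOpen_lt continuous_const Complex.continuous_re).mem_nhds (by simp)
    filter_upwards [this] with s hs using heqLS s hs
  have hEq := hA1.eqOn_of_preconnected_of_eventuallyEq hA2 hUc.isPreconnected h2U hev
  have hβU : (β:ℂ) ∈ U := by
    constructor
    · simp; linarith
    · simp [abs_of_pos hβ]; linarith
  rw [hEq hβU]
  refine tendsto_nhds_unique (gpartial a B hB' β (by simpa using hβ)) ?_
  have h6 := (Complex.continuous_ofReal.tendsto l).comp hl
  refine h6.congr ?_
  intro N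
  simp only [Function.comp]
  push_cast
  rw [conv]
  apply Finset.sum_congr rfl
  intro n _
  rw [ha]
  congr 1
  rw [Complex.ofReal_cpow (by positivity)]
  push_cast
  rfl

/-! ### Part E: Pólya–Vinogradov -/

theorem sum_zmod_range (N : ℕ) [NeZero N] (F : ZMod N → ℂ) :
    ∑ k : ZMod N, F k = ∑ k ∈ Finset.range N, F (k : ZMod N) := by
  refine Finset.sum_bij' (fun k _ => k.val) (fun k _ => (k : ZMod N)) ?_ ?_ ?_ ?_ ?_
  · intro k _; simpa using ZMod.val_lt k
  · intro k _; simp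
  · intro k _; simp
  · intro k hk; exact ZMod.val_cast_of_lt (by simpa using hk)
  · intro k _; simp

theorem gauss_norm {N : ℕ} [NeZero N] (χ : DirichletCharacter ℂ N) (hp : χ.IsPrimitive)
    (hq : χ⁻¹ = χ) : ‖gaussSum χ ZMod.stdAddChar‖ = Real.sqrt N := by
  set G := gaussSum χ ZMod.stdAddChar with hG
  have h1 : ∀ k, ZMod.dft (χ : ZMod N → ℂ) k = χ (-k) * G := by
    intro k
    rw [hp.fourierTransform_eq_inv_mul_gaussSum, hq]
  have h2 := congrFun (ZMod.dft_dft (χ : ZMod N → ℂ)) 1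
  have h3 : ZMod.dft (χ : ZMod N → ℂ) = fun k => χ (-k) * G := funext h1
  rw [h3] at h2
  have h4 : ZMod.dft (fun k => χ (-k) * G) 1 = ZMod.dft (fun k => χ (-k)) 1 * G := by
    rw [ZMod.dft_mul_const]
  rw [h4, ZMod.dft_comp_neg] at h2
  simp only [h1, neg_neg, map_one, one_mul, smul_eq_mul] at h2
  have h5 : ‖χ (-1)‖ = 1 := by
    have : χ (-1) * χ (-1) = 1 := by rw [← map_mul]; simp
    have h6 : ‖χ (-1)‖ * ‖χ (-1)‖ = 1 := by rw [← norm_mul, this]; simp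
    nlinarith [norm_nonneg (χ (-1))]
  have h7 : ‖G‖ * ‖G‖ = N := by
    rw [← norm_mul, h2, norm_mul, h5]; simp
  rw [← h7, Real.sqrt_mul_self (norm_nonneg _)]

theorem geom_bound (w : ℂ) (hw : ‖w‖ = 1) (hw1 : w ≠ 1) (y : ℕ) :
    ‖∑ n ∈ Finset.range y, w ^ (n + 1)‖ ≤ 2 / ‖w - 1‖ := by
  have h0 : w - 1 ≠ 0 := sub_ne_zero.2 hw1
  have h1 : ∑ n ∈ Finset.range y, w ^ (n + 1) = w * ((w ^ y - 1) / (w - 1)) := by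
    rw [← geom_sum_eq hw1, Finset.mul_sum]
    apply Finset.sum_congr rfl
    intro n _; ring
  rw [h1, norm_mul, hw, one_mul, norm_div]
  gcongr
  calc ‖w ^ y - 1‖ ≤ ‖w ^ y‖ + ‖(1:ℂ)‖ := norm_sub_le _ _
    _ = 2 := by rw [norm_pow, hw]; norm_num

theorem stdAddChar_lower (N : ℕ) [NeZero N] (k : ℕ) (hk : 0 < k) (hkN : k < N) :
    2 / ‖(ZMod.stdAddChar (k : ZMod N) : ℂ) - 1‖ ≤ (N / 2 : ℝ) * (1 / k + 1 / ((N - k : ℕ) : ℝ)) := by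
  have hN : (0:ℝ) < N := by exact_mod_cast (by omega : 0 < N)
  have hk' : (0:ℝ) < k := by exact_mod_cast hk
  have hkN' : (k:ℝ) < N := by exact_mod_cast hkN
  have h1 : (ZMod.stdAddChar (k : ZMod N) : ℂ) = Complex.exp (Complex.I * ((2 * Real.pi * k / N : ℝ) : ℂ)) := by
    have := ZMod.stdAddChar_coe (N := N) (k : ℤ)
    push_cast at this
    rw [this]
    congr 1
    push_cast
    ring
  rw [h1, Complex.norm_exp_I_mul_ofReal_sub_one, Nat.cast_sub hkN.le]
  have h2 : 2 * Real.pi * k / N / 2 = Real.pi * (k / N) := by ring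
  rw [h2]
  set θ : ℝ := k / N with hθ
  have hθ0 : 0 < θ := by positivity
  have hθ1 : θ < 1 := by rw [hθ, div_lt_one hN]; exact hkN'
  have hpi := Real.pi_pos
  have hk2 : (k:ℝ) = θ * N := by rw [hθ]; field_simp
  have e1 : (N / 2 : ℝ) * (1 / k + 1 / (N - k)) = (1 / 2) * (1 / θ + 1 / (1 - θ)) := by
    have : (N:ℝ) - k = N * (1 - θ) := by rw [hk2]; ring
    rw [this, hk2]
    have : (1 - θ) ≠ 0 := by linarith
    field_simp
  rw [e1]
  have hpos1 : 0 < 1/θ := by positivity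
  have hpos2 : 0 < 1/(1-θ) := by apply one_div_pos.2; linarith
  have main : ∀ m : ℝ, 0 < m → 2 * m ≤ Real.sin (Real.pi * θ) → 2 / ‖2 * Real.sin (Real.pi * θ)‖ ≤ (1/2) * (1/m) := by
    intro m hm h
    rw [Real.norm_eq_abs, abs_of_nonneg (by linarith)]
    rw [div_le_iff₀ (by linarith)]
    calc (2:ℝ) = 1/2 * (1/m) * (2 * (2 * m)) := by field_simp
      _ ≤ _ := by gcongr
  rcases le_total θ (1/2) with h | h
  · have := Real.mul_le_sin (x := Real.pi * θ) (by positivity) (by nlinarith)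
    have e : 2 / Real.pi * (Real.pi * θ) = 2 * θ := by field_simp
    rw [e] at this
    have := main θ hθ0 this
    linarith
  · have := Real.mul_le_sin (x := Real.pi * (1 - θ)) (by apply mul_nonneg hpi.le; linarith) (by nlinarith)
    have e : 2 / Real.pi * (Real.pi * (1 - θ)) = 2 * (1 - θ) := by field_simp
    have e2 : Real.sin (Real.pi * (1 - θ)) = Real.sin (Real.pi * θ) := by
      rw [← Real.sin_pi_sub]; congr 1; ring
    rw [e, e2] at this
    have := main (1 - θ) (by linarith) this
    linarith

theorem polya_vinogradov {N : ℕ} [NeZero N] (hN : 1 < N) (χ : DirichletCharacter ℂ N) (hp : χ.IsPrimitive)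
    (hq : χ⁻¹ = χ) (y : ℕ) :
    ‖∑ n ∈ Finset.Ioc 0 y, χ (n : ZMod N)‖ ≤ Real.sqrt N * (Real.log N + 1) := by
  set G := gaussSum χ ZMod.stdAddChar with hG
  have hGn := gauss_norm χ hp hq
  have hN0 : (0:ℝ) < N := by positivity
  have : Fact (1 < N) := ⟨hN⟩
  have h1 : ∀ k, ZMod.dft (χ : ZMod N → ℂ) k = χ (-k) * G := by
    intro k
    rw [hp.fourierTransform_eq_inv_mul_gaussSum, hq]
  have h2 : ∀ n : ℕ, (N:ℂ) * χ (n : ZMod N) = G * ∑ k ∈ Finset.range N, χ (-(k : ZMod N)) * (ZMod.stdAddChar (k : ZMod N) : ℂ) ^ n := by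
    intro n
    have h3 := congrFun (ZMod.dft_dft (χ : ZMod N → ℂ)) (-(n : ZMod N))
    simp only [neg_neg, smul_eq_mul] at h3
    rw [← h3, ZMod.dft_apply, sum_zmod_range, Finset.mul_sum]
    apply Finset.sum_congr rfl
    intro k _
    rw [h1, smul_eq_mul]
    have : -((k : ZMod N) * -(n : ZMod N)) = n • (k : ZMod N) := by simp [mul_comm]
    rw [this, AddChar.map_nsmul_eq_pow]
    ring
  have h3 : (N:ℂ) * ∑ n ∈ Finset.Ioc 0 y, χ (n : ZMod N) = G * ∑ k ∈ Finset.range N, χ (-(k : ZMod N)) *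
      ∑ n ∈ Finset.Ioc 0 y, (ZMod.stdAddChar (k : ZMod N) : ℂ) ^ n := by
    rw [Finset.mul_sum, Finset.sum_congr rfl (fun n _ => h2 n), ← Finset.mul_sum, Finset.sum_comm]
    congr 1
    apply Finset.sum_congr rfl
    intro k _
    rw [Finset.mul_sum]
  have conv : ∀ (M : ℕ) (g : ℕ → ℂ), ∑ n ∈ Finset.Ioc 0 M, g n = ∑ n ∈ Finset.range M, g (n+1) := by
    intro N g
    induction N with
    | zero => simp
    | succ N ih => rw [Finset.sum_Ioc_succ_top (by omega), ih, Finset.sum_range_succ]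
  have h4 : ∀ k ∈ Finset.range N, ‖χ (-(k : ZMod N)) *
      ∑ n ∈ Finset.Ioc 0 y, (ZMod.stdAddChar (k : ZMod N) : ℂ) ^ n‖ ≤ if k = 0 then 0 else (N / 2 : ℝ) * (1 / k + 1 / ((N - k : ℕ) : ℝ)) := by
    intro k hk
    rw [Finset.mem_range] at hk
    split_ifs with h0
    · have hz : χ (0 : ZMod N) = 0 := χ.map_nonunit (by simp)
      simp [h0, hz]
    · have hw1 : (ZMod.stdAddChar (k : ZMod N) : ℂ) ≠ 1 := by
        intro h
        have h5 : (ZMod.stdAddChar (k : ZMod N) : ℂ) = ZMod.stdAddChar (0 : ZMod N) := by simpa using h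
        have h6 := ZMod.injective_stdAddChar h5
        have h7 := congrArg ZMod.val h6
        rw [ZMod.val_cast_of_lt hk] at h7
        simp at h7
        exact h0 h7
      have hw : ‖(ZMod.stdAddChar (k : ZMod N) : ℂ)‖ = 1 := by
        rw [ZMod.stdAddChar_apply]; exact Circle.norm_coe _
      rw [norm_mul, conv]
      calc _ ≤ 1 * (2 / ‖(ZMod.stdAddChar (k : ZMod N) : ℂ) - 1‖) := by
            gcongr
            · exact DirichletCharacter.norm_le_one χ _
            · exact geom_bound _ hw hw1 y
        _ ≤ _ := by rw [one_mul]; exact stdAddChar_lower N k (by omega) hk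
  have h5 : ∑ k ∈ Finset.range N, (if k = 0 then (0:ℝ) else (N / 2 : ℝ) * (1 / k + 1 / ((N - k : ℕ) : ℝ))) ≤ N * (Real.log N + 1) := by
    obtain ⟨M, rfl⟩ : ∃ M, N = M + 1 := ⟨N - 1, by omega⟩
    rw [Finset.sum_range_succ']
    simp only [Nat.add_eq_zero_iff, one_ne_zero, and_false, if_false, if_true, add_zero]
    rw [← Finset.mul_sum, Finset.sum_add_distrib]
    have e1 : ∑ k ∈ Finset.range M, 1 / (((M + 1 - (k + 1) : ℕ)) : ℝ) = ∑ k ∈ Finset.range M, 1 / (((k+1 : ℕ)) : ℝ) := by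
      rw [← Finset.sum_range_reflect]
      apply Finset.sum_congr rfl
      intro k hk
      rw [Finset.mem_range] at hk
      congr 2
      omega
    have e2 : ∑ k ∈ Finset.range M, 1 / (((k+1 : ℕ)) : ℝ) ≤ 1 + Real.log (M + 1 : ℕ) := by
      have h := harmonic_le_one_add_log M
      have h' : ((harmonic M : ℚ) : ℝ) = ∑ k ∈ Finset.range M, 1 / (((k+1 : ℕ)) : ℝ) := by
        simp [harmonic]
      rw [← h']
      refine h.trans ?_
      gcongr
      · exact_mod_cast (by omega : 0 < M)
      · omega
    rw [e1]
    have : (0:ℝ) < ((M+1 : ℕ):ℝ) := hN0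
    nlinarith
  have h6 : (N:ℝ) * ‖∑ n ∈ Finset.Ioc 0 y, χ (n : ZMod N)‖ ≤ N * (Real.sqrt N * (Real.log N + 1)) := by
    have e : (N:ℝ) * ‖∑ n ∈ Finset.Ioc 0 y, χ (n : ZMod N)‖ = ‖(N:ℂ) * ∑ n ∈ Finset.Ioc 0 y, χ (n : ZMod N)‖ := by
      rw [norm_mul]; simp
    rw [e, h3, norm_mul, hGn]
    calc _ ≤ Real.sqrt N * (N * (Real.log N + 1)) := by
          gcongr
          exact (norm_sum_le _ _).trans ((Finset.sum_le_sum h4).trans h5)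
      _ = _ := by ring
  exact le_of_mul_le_mul_left h6 hN0

/-! ### Part F: the Jacobi symbol as a character -/

theorem jacobi_val (d : ℕ) [NeZero d] (n : ℤ) : jacobiSym (((n : ZMod d).val : ℕ) : ℤ) d = jacobiSym n d := by
  rw [ZMod.val_intCast, ← jacobiSym.mod_left]

noncomputable def jchar (d : ℕ) [NeZero d] : DirichletCharacter ℂ d where
  toFun a := ((jacobiSym ((a.val : ℕ) : ℤ) d : ℤ) : ℂ)
  map_one' := by
    have h := jacobi_val d 1
    simp only [Int.cast_one] at h
    rw [h]; simp
  map_mul' a b := by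
    have h := jacobi_val d ((a.val : ℤ) * (b.val : ℤ))
    have h2 : (((a.val : ℤ) * (b.val : ℤ) : ℤ) : ZMod d) = a * b := by simp
    rw [h2] at h
    rw [h, jacobiSym.mul_left]
    push_cast
    rfl
  map_nonunit' a ha := by
    have : jacobiSym ((a.val : ℕ) : ℤ) d = 0 := by
      rw [jacobiSym.eq_zero_iff_not_coprime]
      intro h
      apply ha
      rw [Int.gcd_natCast_natCast] at h
      rw [← ZMod.natCast_zmod_val a]
      exact (ZMod.isUnit_iff_coprime _ _).2 h
    simp only [this, Int.cast_zero]

theorem jchar_nat (d : ℕ) [NeZero d] (n : ℕ) : jchar d (n : ZMod d) = ((jacobiSym n d : ℝ) : ℂ) := by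
  have h := jacobi_val d n
  rw [Int.cast_natCast] at h
  show ((jacobiSym _ d : ℤ) : ℂ) = _
  rw [h]; simp

theorem jchar_quadratic (d : ℕ) [NeZero d] : MulChar.IsQuadratic (jchar d) := by
  intro a
  show ((jacobiSym _ d : ℤ) : ℂ) = 0 ∨ ((jacobiSym _ d : ℤ) : ℂ) = 1 ∨ ((jacobiSym _ d : ℤ) : ℂ) = -1
  rcases jacobiSym.trichotomy ((a.val : ℕ) : ℤ) d with h | h | h <;> rw [h] <;> simp

theorem exists_neg (t m p e : ℕ) (hp : p.Prime) (hp2 : p ≠ 2) (ht : t = p ^ e * m) (he : Odd e)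
    (hpm : Nat.Coprime p m) (hm : m ≠ 0) : ∃ a : ℕ, a ≡ 1 [MOD m] ∧ jacobiSym a t = -1 := by
  have : Fact p.Prime := ⟨hp⟩
  obtain ⟨b, hb⟩ := FiniteField.exists_nonsquare (F := ZMod p) (by rw [ZMod.ringChar_zmod_n]; exact hp2)
  obtain ⟨a, ha1, ha2⟩ := Nat.chineseRemainder hpm b.val 1
  refine ⟨a, ha2, ?_⟩
  have h1 : jacobiSym a p = -1 := by
    apply ZMod.nonsquare_iff_jacobiSym_eq_neg_one.2
    have : ((a : ℤ) : ZMod p) = b := by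
      rw [Int.cast_natCast, (ZMod.natCast_eq_natCast_iff _ _ _).2 ha1]; simp
    rw [this]; exact hb
  have h2 : jacobiSym a m = 1 := by
    have h3 : ((a:ℤ) % (m:ℤ)) = ((1:ℤ) % (m:ℤ)) := by exact_mod_cast ha2
    rw [jacobiSym.mod_left' h3, jacobiSym.one_left]
  rw [ht, jacobiSym.mul_right' _ (pow_ne_zero _ hp.ne_zero) hm, jacobiSym.pow_right, h1, h2, he.neg_one_pow]
  norm_num

theorem exists_neg_of_nonsquare (t : ℕ) (ht : Odd t) (hns : ¬ IsSquare t) :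
    ∃ a : ℕ, jacobiSym a t = -1 := by
  have ht0 : t ≠ 0 := by rintro rfl; simp at ht
  obtain ⟨a, b, hab, hsf⟩ := Nat.sq_mul_squarefree t
  have ha0 : a ≠ 0 := by rintro rfl; simp at hsf
  have hb0 : b ≠ 0 := by rintro rfl; simp at hab; exact ht0 hab.symm
  have ha1 : a ≠ 1 := by
    rintro rfl
    exact hns ⟨b, by rw [← hab]; ring⟩
  obtain ⟨p, hp, hpa⟩ := Nat.exists_prime_and_dvd ha1
  have hpt : p ∣ t := hab ▸ hpa.mul_left _
  have hp2 : p ≠ 2 := by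
    rintro rfl
    rw [Nat.odd_iff] at ht; omega
  have hfac : t.factorization p = 2 * b.factorization p + 1 := by
    rw [← hab, Nat.factorization_mul (by positivity) ha0, Nat.factorization_pow]
    have h1 : a.factorization p = 1 := by
      have h2 := (Nat.squarefree_iff_factorization_le_one ha0).1 hsf p
      have h3 := (hp.dvd_iff_one_le_factorization ha0).1 hpa
      omega
    simp [h1]
  obtain ⟨x, _, hx⟩ := exists_neg t (t / p ^ t.factorization p) p (t.factorization p) hp hp2
    (Nat.ordProj_mul_ordCompl_eq_self t p).symm ⟨_, hfac⟩ (Nat.coprime_ordCompl hp ht0)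
    (by have := Nat.ordCompl_pos p ht0; omega)
  exact ⟨x, hx⟩

theorem jchar_ne_one (t : ℕ) [NeZero t] (ht : Odd t) (hns : ¬ IsSquare t) : jchar t ≠ 1 := by
  intro h
  obtain ⟨a, ha⟩ := exists_neg_of_nonsquare t ht hns
  have h1 := jchar_nat t a
  rw [ha, h] at h1
  by_cases hu : IsUnit (a : ZMod t)
  · rw [MulChar.one_apply hu] at h1
    norm_num at h1
  · rw [MulChar.map_nonunit _ hu] at h1
    norm_num at h1

theorem jchar_primitive (d : ℕ) [NeZero d] (hd : Odd d) (hsf : Squarefree d) : (jchar d).IsPrimitive := by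
  rw [DirichletCharacter.isPrimitive_def]
  by_contra hne
  have hcd := DirichletCharacter.conductor_dvd_level (jchar d)
  have hft := DirichletCharacter.factorsThrough_conductor (jchar d)
  set c := (jchar d).conductor with hc
  obtain ⟨q, hq⟩ := hcd
  have hq1 : q ≠ 1 := by rintro rfl; apply hne; rw [hq]; simp
  obtain ⟨p, hp, r, hr⟩ := Nat.exists_prime_and_dvd hq1
  have hdm : d = p ^ 1 * (c * r) := by rw [pow_one, hq, hr]; ring
  have hp2 : p ≠ 2 := by
    rintro rfl
    rw [Nat.odd_iff] at hd
    omega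
  have hcop : Nat.Coprime p (c * r) := by
    rw [pow_one] at hdm
    rw [hdm] at hsf
    exact Nat.coprime_of_squarefree_mul hsf
  have hm0 : c * r ≠ 0 := by
    intro h; rw [h] at hdm; exact NeZero.ne d (by simpa using hdm)
  obtain ⟨a, ha1, ha⟩ := exists_neg d (c * r) p 1 hp hp2 hdm (by decide) hcop hm0
  have hcopd : Nat.Coprime a d := by
    by_contra h
    have : jacobiSym a d = 0 := by
      rw [jacobiSym.eq_zero_iff_not_coprime, Int.gcd_natCast_natCast]; exact h
    rw [this] at ha; norm_num at ha
  have h1 := jchar_nat d a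
  rw [ha] at h1
  obtain ⟨hcd, χ0, hχ⟩ := hft
  have h2 : jchar d (a : ZMod d) = 1 := by
    have h3 := DirichletCharacter.changeLevel_eq_cast_of_dvd χ0 hcd (ZMod.unitOfCoprime a hcopd)
    rw [← hχ] at h3
    simp only [ZMod.coe_unitOfCoprime] at h3
    rw [h3, ZMod.cast_natCast hcd]
    have : (a : ZMod c) = ((1:ℕ) : ZMod c) := (ZMod.natCast_eq_natCast_iff _ _ _).2 (ha1.of_mul_right r)
    rw [this]; simp
  rw [h2] at h1
  norm_num at h1

theorem RC_jacobi (d : ℕ) (hd : 1 < d) : RC (fun n => (jacobiSym n d : ℝ)) where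
  zero := by simp [jacobiSym.zero_left hd]
  one := by simp
  mul := by intro m n; push_cast; rw [jacobiSym.mul_left]; push_cast; rfl
  tri := by
    intro n
    rcases jacobiSym.trichotomy (n : ℤ) d with h | h | h <;> rw [h] <;> simp

theorem periodic_bound (F : ℕ → ℝ) (t : ℕ) (ht : 0 < t) (hF : ∀ n, |F n| ≤ 1) (hper : ∀ n, F (n + t) = F n)
    (hz : ∑ n ∈ Finset.range t, F n = 0) (K : ℕ) : |∑ n ∈ Finset.range K, F n| ≤ t := by
  induction K using Nat.strong_induction_on with
  | _ K ih =>
    rcases lt_or_ge K t with h | h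
    · refine (Finset.abs_sum_le_sum_abs _ _).trans ?_
      refine (Finset.sum_le_sum (fun n _ => hF n)).trans ?_
      simp; exact_mod_cast h.le
    · obtain ⟨r, rfl⟩ := Nat.exists_eq_add_of_le h
      rw [Finset.sum_range_add, hz, zero_add]
      have e : ∑ x ∈ Finset.range r, F (t + x) = ∑ x ∈ Finset.range r, F x := by
        apply Finset.sum_congr rfl
        intro x _
        rw [add_comm, hper]
      rw [e]
      exact ih r (by omega)

theorem jacobi_family_bound (t P c K : ℕ) (ht : Odd t) (hns : ¬ IsSquare t) (hcop : Nat.Coprime P t) :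
    |∑ j ∈ Finset.range K, (jacobiSym ((c + P * j : ℕ) : ℤ) t : ℝ)| ≤ t := by
  have ht0 : 0 < t := ht.pos
  have : NeZero t := ⟨ht0.ne'⟩
  apply periodic_bound (fun j => (jacobiSym ((c + P * j : ℕ) : ℤ) t : ℝ)) t ht0
  · intro n
    rcases jacobiSym.trichotomy ((c + P * n : ℕ) : ℤ) t with h | h | h <;> rw [h] <;> simp
  · intro n
    have : jacobiSym ((c + P * (n + t) : ℕ) : ℤ) t = jacobiSym ((c + P * n : ℕ) : ℤ) t := by
      apply jacobiSym.mod_left'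
      have : ((c + P * (n + t) : ℕ) : ℤ) = ((c + P * n : ℕ) : ℤ) + P * t := by push_cast; ring
      rw [this, Int.add_mul_emod_self_right]
    simp only [this]
  · have h0 := MulChar.sum_eq_zero_of_ne_one (jchar_ne_one t ht hns)
    have hu : IsUnit (P : ZMod t) := (ZMod.isUnit_iff_coprime _ _).2 hcop
    obtain ⟨u, hu⟩ := hu
    have h1 : ∑ b : ZMod t, jchar t ((c : ZMod t) + P * b) = 0 := by
      rw [← h0]
      refine Fintype.sum_equiv ((Units.mulLeft u).trans (Equiv.addLeft (c : ZMod t))) _ _ ?_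
      intro b
      simp [hu]
    rw [sum_zmod_range] at h1
    have h2 : (((∑ j ∈ Finset.range t, (jacobiSym ((c + P * j : ℕ) : ℤ) t : ℝ)) : ℝ) : ℂ) = 0 := by
      rw [← h1]
      rw [Complex.ofReal_sum]
      apply Finset.sum_congr rfl
      intro j _
      rw [← jchar_nat]
      push_cast
      rfl
    exact_mod_cast h2

/-! ### Part G: averaging over the family -/

def Smo (z n : ℕ) : Prop := ∀ p, p.Prime → p ∣ n → p ≤ z

theorem decomp (z n : ℕ) (hn : 0 < n) : ∃ s t, n = s * t ∧ Smo z s ∧ 0 < s ∧ 0 < t ∧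
    ∀ p, p.Prime → p ∣ t → z < p := by
  revert hn
  induction n using induction_on_primes with
  | zero => intro h; omega
  | one =>
    intro _
    refine ⟨1, 1, rfl, ?_, by norm_num, by norm_num, ?_⟩
    · intro p hp h; exact absurd (Nat.dvd_one.1 h) hp.ne_one
    · intro p hp h; exact absurd (Nat.dvd_one.1 h) hp.ne_one
  | prime_mul p a hp ih =>
    intro h
    obtain ⟨s, t, hst, hs, hs0, ht0, ht⟩ := ih (Nat.pos_of_mul_pos_left h)
    rcases le_or_gt p z with hpz | hpz
    · refine ⟨p * s, t, by rw [hst]; ring, ?_, Nat.mul_pos hp.pos hs0, ht0, ht⟩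
      intro q hq hqd
      rcases (hq.dvd_mul).1 hqd with h1 | h1
      · rw [(Nat.prime_dvd_prime_iff_eq hq hp).1 h1]; exact hpz
      · exact hs q hq h1
    · refine ⟨s, p * t, by rw [hst]; ring, hs, hs0, Nat.mul_pos hp.pos ht0, ?_⟩
      intro q hq hqd
      rcases (hq.dvd_mul).1 hqd with h1 | h1
      · rw [(Nat.prime_dvd_prime_iff_eq hq hp).1 h1]; exact hpz
      · exact ht q hq h1

theorem jacobi_smooth (z P d k : ℕ) (h8 : 8 ∣ P) (hP : ∀ p, p.Prime → p ≤ z → p ∣ P) (hd : d = 1 + P * k)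
    (s : ℕ) (hs0 : 0 < s) (hs : Smo z s) : jacobiSym s d = 1 := by
  have hd8 : d % 8 = 1 := by
    obtain ⟨q, rfl⟩ := h8
    rw [hd, mul_assoc]; omega
  revert hs0 hs
  induction s using induction_on_primes with
  | zero => intro h; omega
  | one => intro _ _; simp
  | prime_mul p a hp ih =>
    intro h hs
    have ha : jacobiSym a d = 1 := ih (Nat.pos_of_mul_pos_left h) (fun q hq hqa => hs q hq (hqa.mul_left p))
    rw [Nat.cast_mul, jacobiSym.mul_left, ha, mul_one]
    have hpP := hP p hp (hs p hp (dvd_mul_right p a))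
    rcases hp.eq_two_or_odd' with h2 | hodd
    · subst h2
      have hodd : Odd d := by rw [Nat.odd_iff]; omega
      rw [Nat.cast_ofNat, jacobiSym.at_two hodd]
      have : (d : ZMod 8) = 1 := by
        have : d ≡ 1 [MOD 8] := hd8
        have := (ZMod.natCast_eq_natCast_iff _ _ _).2 this
        simpa using this
      rw [this]; simp
    · rw [jacobiSym.quadratic_reciprocity_one_mod_four' hodd (by omega)]
      have : ((d : ℕ) : ℤ) % (p : ℤ) = (1 : ℤ) % (p : ℤ) := by
        obtain ⟨q, rfl⟩ := hpP
        rw [hd]; push_cast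
        rw [mul_assoc, Int.add_mul_emod_self_left]
      rw [jacobiSym.mod_left' this, jacobiSym.one_left]

def fam (P K j : ℕ) : ℕ := 1 + P * (K + j)

noncomputable def W (P K n : ℕ) : ℝ := ∑ j ∈ Finset.range K, (jacobiSym n (fam P K j) : ℝ)

def Gd (z n : ℕ) : Prop := ∃ s u, n = s * u ^ 2 ∧ Smo z s ∧ 0 < s ∧ 0 < u

theorem jac_le_one (a : ℤ) (d : ℕ) : (jacobiSym a d : ℝ) ≤ 1 := by
  rcases jacobiSym.trichotomy a d with h | h | h <;> rw [h] <;> norm_num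

theorem W_cases (z P K n : ℕ) (hz : 2 ≤ z) (h8 : 8 ∣ P) (hP : ∀ p, p.Prime → p ≤ z → p ∣ P)
    (hP' : ∀ p, p.Prime → p ∣ P → p ≤ z) (hn : 0 < n) :
    (Smo z n → W P K n = K) ∧ (Gd z n → 0 ≤ W P K n ∧ W P K n ≤ K) ∧ (¬ Gd z n → |W P K n| ≤ n) := by
  refine ⟨?_, ?_, ?_⟩
  · intro hs
    unfold W
    rw [Finset.sum_congr rfl (fun j _ => by
      rw [jacobi_smooth z P (fam P K j) (K + j) h8 hP rfl n hn hs])]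
    simp
  · rintro ⟨s, u, rfl, hs, hs0, hu0⟩
    have key : ∀ j, 0 ≤ (jacobiSym ((s * u ^ 2 : ℕ) : ℤ) (fam P K j) : ℝ) := by
      intro j
      rw [Nat.cast_mul, jacobiSym.mul_left, jacobi_smooth z P (fam P K j) (K + j) h8 hP rfl s hs0 hs,
        Nat.cast_pow, jacobiSym.pow_left]
      push_cast
      positivity
    constructor
    · exact Finset.sum_nonneg (fun j _ => key j)
    · refine (Finset.sum_le_sum (fun j _ => jac_le_one _ _)).trans ?_
      simp
  · intro hg
    obtain ⟨s, t, hst, hs, hs0, ht0, ht⟩ := decomp z n hn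
    have hns : ¬ IsSquare t := by
      rintro ⟨u, hu⟩
      refine hg ⟨s, u, by rw [hst, hu]; ring, hs, hs0, ?_⟩
      rcases Nat.eq_zero_or_pos u with h | h
      · rw [h] at hu; omega
      · exact h
    have hodd : Odd t := by
      rw [Nat.odd_iff]
      by_contra h
      have := ht 2 Nat.prime_two (by omega)
      omega
    have hcop : Nat.Coprime P t := by
      apply Nat.Coprime.symm
      apply Nat.coprime_of_dvd
      intro p hp h1 h2
      have := ht p hp h1
      have := hP' p hp h2
      omega
    have e : W P K n = ∑ j ∈ Finset.range K, (jacobiSym (((1 + P * K) + P * j : ℕ) : ℤ) t : ℝ) := by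
      unfold W
      apply Finset.sum_congr rfl
      intro j _
      have h4 : fam P K j % 4 = 1 := by
        obtain ⟨q, rfl⟩ := h8
        unfold fam
        rw [mul_assoc]; omega
      rw [hst, Nat.cast_mul, jacobiSym.mul_left, jacobi_smooth z P (fam P K j) (K + j) h8 hP rfl s hs0 hs, one_mul,
        jacobiSym.quadratic_reciprocity_one_mod_four' hodd h4]
      unfold fam
      rw [mul_add, ← add_assoc]
    rw [e]
    refine (jacobi_family_bound t P (1 + P * K) K hodd hns hcop).trans ?_
    have : t ≤ n := by rw [hst]; exact Nat.le_mul_of_pos_left t hs0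
    exact_mod_cast this

noncomputable def Hs (x : ℕ) : ℝ := ∑ k ∈ Finset.Ioc 0 x, 1 / (k : ℝ)

noncomputable def Ssum (d x : ℕ) : ℝ := ∑ n ∈ Finset.Ioc 0 x, (jacobiSym n d : ℝ) / n

noncomputable def Rsum (d x : ℕ) : ℝ := ∑ m ∈ Finset.Ioc 0 x, (jacobiSym m d : ℝ) / m * Hs (x / m)

theorem Hs_nonneg (x : ℕ) : 0 ≤ Hs x := Finset.sum_nonneg (fun k _ => by positivity)

theorem Hs_mono {x y : ℕ} (h : x ≤ y) : Hs x ≤ Hs y := by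
  apply Finset.sum_le_sum_of_subset_of_nonneg
  · exact Finset.Ioc_subset_Ioc_right h
  · intro i _ _; positivity

theorem Ssum_le (d x : ℕ) : Ssum d x ≤ Hs x := by
  apply Finset.sum_le_sum
  intro n _
  gcongr
  exact jac_le_one _ _

theorem Rsum_nonneg (d x : ℕ) (hd : 1 < d) : 0 ≤ Rsum d x := by
  have h := sum_divisors_hyperbola (fun a b => (jacobiSym a d : ℝ) / (a * b)) x
  have e : Rsum d x = ∑ m ∈ Finset.Ioc 0 x, ∑ k ∈ Finset.Ioc 0 (x/m), (jacobiSym m d : ℝ) / (m * k) := by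
    unfold Rsum Hs
    apply Finset.sum_congr rfl
    intro m _
    rw [Finset.mul_sum]
    apply Finset.sum_congr rfl
    intro k _
    rw [div_mul_div_comm, mul_one]
  rw [e, ← h]
  apply Finset.sum_nonneg
  intro n _
  have e2 : ∑ q ∈ n.divisorsAntidiagonal, (jacobiSym q.1 d : ℝ) / ((q.1 : ℝ) * q.2) =
      (∑ q ∈ n.divisorsAntidiagonal, (jacobiSym q.1 d : ℝ)) / n := by
    rw [Finset.sum_div]
    apply Finset.sum_congr rfl
    intro q hq
    rw [Nat.mem_divisorsAntidiagonal] at hq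
    rw [← hq.1]; push_cast; rfl
  rw [e2]
  exact div_nonneg ((RC_jacobi d hd).r_nonneg n) (by positivity)

open Classical in
noncomputable def Msum (z x : ℕ) : ℝ := ∑ n ∈ (Finset.Ioc 0 x).filter (Smo z), 1 / (n : ℝ)

open Classical in
theorem Msum_ge (z x : ℕ) (hzx : z ≤ x) : Real.log (z + 1) ≤ Msum z x := by
  have h1 : Real.log (z + 1) ≤ Hs z := by
    have h := log_add_one_le_harmonic z
    have e : ((harmonic z : ℚ) : ℝ) = Hs z := by
      unfold Hs
      rw [harmonic_eq_sum_Icc]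
      push_cast
      apply Finset.sum_congr
      · ext; simp [Nat.lt_iff_add_one_le]
      · intros; simp
    rw [← e]
    exact_mod_cast h
  refine h1.trans ?_
  apply Finset.sum_le_sum_of_subset_of_nonneg
  · intro n hn
    rw [Finset.mem_Ioc] at hn
    rw [Finset.mem_filter, Finset.mem_Ioc]
    refine ⟨⟨hn.1, by omega⟩, ?_⟩
    intro p _ hpn
    exact (Nat.le_of_dvd hn.1 hpn).trans hn.2
  · intro i _ _; positivity

open Classical in
theorem good_sum_le (z x : ℕ) : ∑ n ∈ (Finset.Ioc 0 x).filter (Gd z), 1 / (n : ℝ) ≤ 2 * Msum z x := by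
  set T := ((Finset.Ioc 0 x).filter (Smo z)) ×ˢ (Finset.Ioc 0 x) with hT
  have hsub : (Finset.Ioc 0 x).filter (Gd z) ⊆ (T.image (fun q => q.1 * q.2 ^ 2) : Finset ℕ) := by
    intro n hn
    rw [Finset.mem_filter, Finset.mem_Ioc] at hn
    obtain ⟨⟨hn0, hnx⟩, s, u, rfl, hs, hs0, hu0⟩ := hn
    rw [Finset.mem_image]
    refine ⟨(s, u), ?_, rfl⟩
    rw [hT, Finset.mem_product, Finset.mem_filter, Finset.mem_Ioc, Finset.mem_Ioc]
    have h1 : s ≤ s * u ^ 2 := Nat.le_mul_of_pos_right s (by positivity)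
    have h2 : u ≤ s * u ^ 2 := by
      calc u ≤ u ^ 2 := Nat.le_self_pow (by norm_num) u
        _ ≤ s * u ^ 2 := Nat.le_mul_of_pos_left _ hs0
    exact ⟨⟨⟨hs0, by simp only; omega⟩, hs⟩, hu0, by simp only; omega⟩
  have h1 : ∑ n ∈ (Finset.Ioc 0 x).filter (Gd z), 1 / (n : ℝ) ≤ ∑ n ∈ (T.image (fun q => q.1 * q.2 ^ 2) : Finset ℕ), 1 / (n : ℝ) :=
    Finset.sum_le_sum_of_subset_of_nonneg hsub (fun i _ _ => by positivity)
  have h2 : ∑ n ∈ (T.image (fun q => q.1 * q.2 ^ 2) : Finset ℕ), 1 / (n : ℝ) ≤ ∑ q ∈ T, 1 / ((q.1 * q.2 ^ 2 : ℕ) : ℝ) := by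
    rw [← Finset.sum_fiberwise_of_maps_to (g := fun q : ℕ × ℕ => q.1 * q.2 ^ 2) (t := (T.image (fun q => q.1 * q.2 ^ 2) : Finset ℕ)) (fun q hq => Finset.mem_image_of_mem _ hq)]
    apply Finset.sum_le_sum
    intro n hn
    obtain ⟨q, hq, hqn⟩ := Finset.mem_image.1 hn
    have := Finset.single_le_sum (s := T.filter (fun q => q.1 * q.2 ^ 2 = n)) (f := fun q : ℕ × ℕ => 1 / ((q.1 * q.2 ^ 2 : ℕ) : ℝ))
      (fun i _ => by positivity) (Finset.mem_filter.2 ⟨hq, hqn⟩)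
    rw [hqn] at this
    exact this
  have h3 : ∑ q ∈ T, 1 / ((q.1 * q.2 ^ 2 : ℕ) : ℝ) = Msum z x * ∑ u ∈ Finset.Ioc 0 x, 1 / (u : ℝ) ^ 2 := by
    unfold Msum
    rw [Finset.sum_mul_sum, hT, Finset.sum_product]
    apply Finset.sum_congr rfl
    intro s _
    apply Finset.sum_congr rfl
    intro u _
    push_cast
    rw [div_mul_div_comm, one_mul]
  have hM : 0 ≤ Msum z x := Finset.sum_nonneg (fun i _ => by positivity)
  have := sum_inv_sq_le x
  calc _ ≤ _ := h1
    _ ≤ _ := h2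
    _ = _ := h3
    _ ≤ Msum z x * 2 := by gcongr
    _ = _ := by ring

theorem sum_Ssum (P K x : ℕ) : ∑ j ∈ Finset.range K, Ssum (fam P K j) x = ∑ n ∈ Finset.Ioc 0 x, W P K n / n := by
  unfold Ssum W
  rw [Finset.sum_comm]
  apply Finset.sum_congr rfl
  intro n _
  rw [Finset.sum_div]

theorem sum_Rsum (P K x : ℕ) : ∑ j ∈ Finset.range K, Rsum (fam P K j) x =
    ∑ n ∈ Finset.Ioc 0 x, W P K n / n * Hs (x / n) := by
  unfold Rsum W
  rw [Finset.sum_comm]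
  apply Finset.sum_congr rfl
  intro n _
  rw [Finset.sum_div, Finset.sum_mul]

open Classical in
theorem sum_Ssum_ge (z P K x : ℕ) (hz : 2 ≤ z) (h8 : 8 ∣ P) (hP : ∀ p, p.Prime → p ≤ z → p ∣ P)
    (hP' : ∀ p, p.Prime → p ∣ P → p ≤ z) :
    K * Msum z x - x ≤ ∑ j ∈ Finset.range K, Ssum (fam P K j) x := by
  rw [sum_Ssum]
  have e : K * Msum z x - x = ∑ n ∈ Finset.Ioc 0 x, ((if Smo z n then (K:ℝ) * (1 / n) else 0) - 1) := by
    rw [Finset.sum_sub_distrib, ← Finset.sum_filter]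
    unfold Msum
    rw [Finset.mul_sum]
    simp
  rw [e]
  apply Finset.sum_le_sum
  intro n hn
  rw [Finset.mem_Ioc] at hn
  have hn' : (0:ℝ) < n := by exact_mod_cast hn.1
  obtain ⟨h1, h2, h3⟩ := W_cases z P K n hz h8 hP hP' hn.1
  split_ifs with hs
  · rw [h1 hs]
    have : (K:ℝ) * (1 / n) = K / n := by ring
    linarith
  · have : -(n:ℝ) ≤ W P K n := by
      by_cases hg : Gd z n
      · linarith [(h2 hg).1]
      · exact (abs_le.1 (h3 hg)).1
    rw [zero_sub, le_div_iff₀ hn']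
    linarith

open Classical in
theorem sum_Rsum_le (z P K x : ℕ) (hz : 2 ≤ z) (h8 : 8 ∣ P) (hP : ∀ p, p.Prime → p ≤ z → p ∣ P)
    (hP' : ∀ p, p.Prime → p ∣ P → p ≤ z) :
    ∑ j ∈ Finset.range K, Rsum (fam P K j) x ≤ Hs x * (2 * K * Msum z x + x) := by
  rw [sum_Rsum]
  have h0 : ∑ n ∈ Finset.Ioc 0 x, W P K n / n * Hs (x / n) ≤
      ∑ n ∈ Finset.Ioc 0 x, ((if Gd z n then (K:ℝ) * (1 / n) else 0) + 1) * Hs x := by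
    apply Finset.sum_le_sum
    intro n hn
    rw [Finset.mem_Ioc] at hn
    have hn' : (0:ℝ) < n := by exact_mod_cast hn.1
    obtain ⟨h1, h2, h3⟩ := W_cases z P K n hz h8 hP hP' hn.1
    apply mul_le_mul _ (Hs_mono (Nat.div_le_self x n)) (Hs_nonneg _)
    · split_ifs <;> positivity
    · split_ifs with hg
      · have : W P K n / n ≤ K / n := by
          gcongr; exact (h2 hg).2
        have e : (K:ℝ) * (1 / n) = K / n := by ring
        linarith
      · rw [div_le_iff₀ hn']
        have := (abs_le.1 (h3 hg)).2
        linarith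
  refine h0.trans ?_
  rw [← Finset.sum_mul, mul_comm]
  apply mul_le_mul_of_nonneg_left _ (Hs_nonneg x)
  rw [Finset.sum_add_distrib, ← Finset.sum_filter, ← Finset.mul_sum]
  have := good_sum_le z x
  have hK : (0:ℝ) ≤ K := by positivity
  have := mul_le_mul_of_nonneg_left this hK
  simp only [Finset.sum_const, Nat.card_Ioc, tsub_zero, nsmul_eq_mul, mul_one]
  linarith

theorem card_class (S : Finset ℕ) (K m : ℕ) (hS : S ⊆ Finset.range K)
    (h : ∀ a ∈ S, ∀ b ∈ S, a ≡ b [MOD m]) : S.card ≤ K / m + 1 := by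
  rw [← Finset.card_range (K / m + 1)]
  apply Finset.card_le_card_of_injOn (fun j => j / m)
  · intro j hj
    have := Finset.mem_range.1 (hS hj)
    simp only [Finset.coe_range, Set.mem_Iio]
    exact Nat.lt_succ_of_le (Nat.div_le_div_right this.le)
  · intro a ha b hb hab
    simp only at hab
    have h1 := h a ha b hb
    rw [← Nat.div_add_mod a m, ← Nat.div_add_mod b m, hab, h1]

open Classical in
theorem nonsqfree_card (z P K Y : ℕ) (hz : 2 ≤ z) (hP : ∀ p, p.Prime → p ≤ z → p ∣ P)
    (hY : 1 + 2 * P * K ≤ Y ^ 2) (hzY : z ≤ Y) :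
    (((Finset.range K).filter (fun j => ¬ Squarefree (fam P K j))).card : ℝ) ≤ K / z + Y := by
  set A : ℕ → Finset ℕ := fun p => (Finset.range K).filter (fun j => p.Prime ∧ p * p ∣ fam P K j) with hA
  have hsub : (Finset.range K).filter (fun j => ¬ Squarefree (fam P K j)) ⊆ (Finset.Ioc z Y).biUnion A := by
    intro j hj
    rw [Finset.mem_filter, Finset.mem_range] at hj
    obtain ⟨hjK, hns⟩ := hj
    rw [Nat.squarefree_iff_prime_squarefree] at hns
    push Not at hns
    obtain ⟨p, hp, hpd⟩ := hns
    rw [Finset.mem_biUnion]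
    refine ⟨p, ?_, by rw [hA]; simp only [Finset.mem_filter, Finset.mem_range]; exact ⟨hjK, hp, hpd⟩⟩
    rw [Finset.mem_Ioc]
    constructor
    · by_contra hle
      have h1 := hP p hp (by omega)
      have h2 : p ∣ 1 := by
        have h3 : p ∣ fam P K j := (dvd_mul_right p p).trans hpd
        unfold fam at h3
        exact (Nat.dvd_add_left (h1.mul_right (K + j))).1 h3
      exact hp.one_lt.ne' (Nat.dvd_one.1 h2)
    · have h1 : p * p ≤ fam P K j := Nat.le_of_dvd (by unfold fam; omega) hpd
      have h2 : fam P K j ≤ 1 + 2 * P * K := by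
        unfold fam
        have : P * (K + j) ≤ P * (2 * K) := Nat.mul_le_mul_left _ (by omega)
        nlinarith
      by_contra h
      push Not at h
      nlinarith
  have hcard : ∀ p ∈ Finset.Ioc z Y, ((A p).card : ℝ) ≤ K * ((p:ℝ) ^ 2)⁻¹ + 1 := by
    intro p _
    by_cases hp : p.Prime
    · have h1 : (A p).card ≤ K / (p * p) + 1 := by
        apply card_class _ _ _ (Finset.filter_subset _ _)
        intro a ha b hb
        simp only [Finset.mem_filter] at ha hb
        have ha' := ha.2.2
        have hb' := hb.2.2
        have hcop : Nat.Coprime p P := by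
          rw [hp.coprime_iff_not_dvd]
          intro h1
          have h3 : p ∣ fam P K a := (dvd_mul_right p p).trans ha'
          unfold fam at h3
          exact hp.one_lt.ne' (Nat.dvd_one.1 ((Nat.dvd_add_left (h1.mul_right (K + a))).1 h3))
        have hcop2 : Nat.Coprime (p * p) P := Nat.Coprime.mul_left hcop hcop
        have h4 : fam P K a ≡ fam P K b [MOD (p * p)] :=
          ((Nat.modEq_zero_iff_dvd).2 ha').trans ((Nat.modEq_zero_iff_dvd).2 hb').symm
        unfold fam at h4
        have h5 := Nat.ModEq.add_left_cancel' 1 h4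
        have h6 := Nat.ModEq.cancel_left_of_coprime hcop2 h5
        exact Nat.ModEq.add_left_cancel' K h6
      have h2 : ((A p).card : ℝ) ≤ ((K / (p * p) : ℕ) : ℝ) + 1 := by exact_mod_cast h1
      have h3 : ((K / (p * p) : ℕ) : ℝ) ≤ K / ((p * p : ℕ) : ℝ) := Nat.cast_div_le
      have e : (K:ℝ) / ((p * p : ℕ) : ℝ) = K * ((p:ℝ) ^ 2)⁻¹ := by push_cast; rw [div_eq_mul_inv, sq]
      linarith
    · have : A p = ∅ := by
        rw [hA]; ext j; simp [hp]
      rw [this]; simp; positivity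
  have h1 : (((Finset.range K).filter (fun j => ¬ Squarefree (fam P K j))).card : ℝ) ≤ ∑ p ∈ Finset.Ioc z Y, ((A p).card : ℝ) := by
    exact_mod_cast (Finset.card_le_card hsub).trans Finset.card_biUnion_le
  have h2 := Finset.sum_le_sum hcard
  rw [Finset.sum_add_distrib, ← Finset.mul_sum] at h2
  have h3 := sum_Ioc_inv_sq_le_sub (α := ℝ) (by omega : z ≠ 0) hzY
  have hY0 : (0:ℝ) ≤ (Y:ℝ)⁻¹ := by positivity
  have h4 : (K:ℝ) * ∑ i ∈ Finset.Ioc z Y, ((i:ℝ) ^ 2)⁻¹ ≤ K * (z:ℝ)⁻¹ :=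
    mul_le_mul_of_nonneg_left (by linarith) (by positivity)
  have h5 : (∑ i ∈ Finset.Ioc z Y, (1:ℝ)) ≤ Y := by
    simp
  rw [div_eq_mul_inv]
  linarith

open Classical in
theorem family_count (z P K x Y : ℕ) (θ τ V : ℝ) (hz : 2 ≤ z) (h8 : 8 ∣ P) (hP0 : 0 < P) (hK : 0 < K)
    (hP : ∀ p, p.Prime → p ≤ z → p ∣ P) (hP' : ∀ p, p.Prime → p ∣ P → p ≤ z) (hzx : z ≤ x)
    (hY : 1 + 2 * P * K ≤ Y ^ 2) (hzY : z ≤ Y) (hθ : 0 ≤ θ) (hθH : θ * Hs x ≤ 1 / 4) (hV : Hs x ≤ V)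
    (hτ : 0 ≤ τ) :
    K * (Real.log (z + 1) / 2) - 2 * x - τ * K - V * (K / z + Y) ≤
      V * (((Finset.range K).filter (fun j => Squarefree (fam P K j) ∧
        τ ≤ Ssum (fam P K j) x - θ * Rsum (fam P K j) x)).card : ℝ) := by
  have hV0 : 0 ≤ V := (Hs_nonneg x).trans hV
  have hS := sum_Ssum_ge z P K x hz h8 hP hP'
  have hR := sum_Rsum_le z P K x hz h8 hP hP'
  have hN := nonsqfree_card z P K Y hz hP hY hzY
  have hM := Msum_ge z x hzx
  set X : ℕ → ℝ := fun j => Ssum (fam P K j) x - θ * Rsum (fam P K j) x with hX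
  have hM0 : 0 ≤ Msum z x := Finset.sum_nonneg (fun i _ => by positivity)
  have hsumX : K * (Real.log (z + 1) / 2) - 2 * x ≤ ∑ j ∈ Finset.range K, X j := by
    rw [hX, Finset.sum_sub_distrib, ← Finset.mul_sum]
    have h1 : θ * ∑ j ∈ Finset.range K, Rsum (fam P K j) x ≤ (1/4) * (2 * K * Msum z x + x) := by
      calc _ ≤ θ * (Hs x * (2 * K * Msum z x + x)) := by gcongr
        _ = (θ * Hs x) * (2 * K * Msum z x + x) := by ring
        _ ≤ _ := by gcongr
    have h2 : (K:ℝ) * Real.log (z+1) ≤ K * Msum z x := by gcongr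
    have h3 : (0:ℝ) ≤ x := by positivity
    nlinarith
  have hXle : ∀ j ∈ Finset.range K, X j ≤ V * (if (Squarefree (fam P K j) ∧ τ ≤ X j) then 1 else 0) +
      V * (if ¬ Squarefree (fam P K j) then 1 else 0) + τ := by
    intro j _
    have hd : 1 < fam P K j := by
      unfold fam
      have : 0 < P * (K + j) := by positivity
      omega
    have h1 : X j ≤ V := by
      have a1 := Ssum_le (fam P K j) x
      have a2 := mul_nonneg hθ (Rsum_nonneg (fam P K j) x hd)
      simp only [hX]; linarith
    by_cases hsf : Squarefree (fam P K j)
    · by_cases ht : τ ≤ X j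
      · simp [hsf, ht]; linarith
      · simp [hsf, ht]; linarith
    · simp [hsf]; linarith
  have h4 := Finset.sum_le_sum hXle
  rw [Finset.sum_add_distrib, Finset.sum_add_distrib, ← Finset.mul_sum, ← Finset.mul_sum, Finset.sum_boole, Finset.sum_boole] at h4
  simp only [Finset.sum_const, Finset.card_range, nsmul_eq_mul] at h4
  have h5 := mul_le_mul_of_nonneg_left hN hV0
  linarith

theorem good_d (d x : ℕ) (LD τ : ℝ) (hd1 : 1 < d) (hd4 : d % 4 = 1) (hsf : Squarefree d) (hx : 1 ≤ x)
    (hLD : 16 ≤ LD) (hlogd : LD / 2 ≤ Real.log d)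
    (hB : 2 * (Real.sqrt d * (Real.log d + 1)) / x ≤ 1 / 4) (hτ : 1 ≤ τ)
    (hX : τ ≤ Ssum d x - (1 / 8 / LD) * Rsum d x) :
    ∃ χ : DirichletCharacter ℂ d, χ.IsPrimitive ∧ MulChar.IsQuadratic χ ∧
              HasNoSiegelZero (1/16) d χ ∧
              ∃ L : ℝ, HasCurlyL χ L ∧ Real.log (τ - 1/4) - 6 ≤ L := by
  have hd0 : d ≠ 0 := by omega
  have : NeZero d := ⟨hd0⟩
  have hodd : Odd d := by rw [Nat.odd_iff]; omega
  set B := Real.sqrt d * (Real.log d + 1) with hBdef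
  have hxp : (0:ℝ) < x := by exact_mod_cast hx
  set f : ℕ → ℝ := fun n => (jacobiSym n d : ℝ) with hf
  have hRC : RC f := RC_jacobi d hd1
  have hprim := jchar_primitive d hodd hsf
  have hquad := jchar_quadratic d
  have hχf : ∀ n : ℕ, jchar d (n : ZMod d) = (f n : ℂ) := jchar_nat d
  have hB0 : 0 ≤ B := by
    have : 0 ≤ Real.log d := by linarith
    positivity
  have hBb : ∀ n, |∑ k ∈ Finset.Ioc 0 n, f k| ≤ B := by
    intro n
    have h := polya_vinogradov hd1 (jchar d) hprim hquad.inv n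
    rw [Finset.sum_congr rfl (fun k _ => hχf k), ← Complex.ofReal_sum, Complex.norm_real] at h
    exact h
  have hne1 : jchar d ≠ 1 := by
    apply jchar_ne_one d hodd
    rintro ⟨u, hu⟩
    have h2 : u = 1 := by
      have := hsf u (by rw [hu])
      exact Nat.isUnit_iff.1 this
    rw [h2] at hu; omega
  have hR0 := Rsum_nonneg d x hd1
  have hLDp : 0 < LD := by linarith
  have hSτ : τ ≤ Ssum d x := by
    have : 0 ≤ (1 / 8 / LD) * Rsum d x := by positivity
    linarith
  obtain ⟨l, hlt, hl⟩ := RC.exists_one (f := f) B hBb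
  have hlS : τ - 1/4 ≤ l := by
    have h1 := (abs_le.1 (hl x)).1
    have h2 : 2 * B / ((x:ℝ) + 1) ≤ 2 * B / x := by gcongr; linarith
    have h3 : ∑ n ∈ Finset.Ioc 0 x, f n / n = Ssum d x := rfl
    rw [h3] at h1
    linarith
  have hl0 : 0 < l := by linarith
  refine ⟨jchar d, hprim, hquad, ?_, ?_⟩
  · rintro ⟨β, hβ1, hβ2, hβ0⟩
    unfold LFun at hβ0
    rw [dif_pos hd0] at hβ0
    have hlogp : 0 < Real.log d := by linarith
    have hκ : 1 - β ≤ 1 / 8 / LD := by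
      have : 1 / 16 / Real.log d ≤ 1 / 16 / (LD / 2) := by gcongr
      have e : 1 / 16 / (LD / 2) = 1 / 8 / LD := by field_simp; norm_num
      linarith
    have hsm : 1 / 8 / LD ≤ 1 / 128 := by
      rw [div_le_iff₀ hLDp]; linarith
    have hβpos : 0 < β := by linarith
    rcases hβ2.lt_or_eq with hlt1 | heq
    · have hlim0 : Tendsto (fun n : ℕ => (n:ℝ) ^ (-β)) atTop (nhds 0) :=
        (tendsto_rpow_neg_atTop hβpos).comp tendsto_natCast_atTop_atTop
      obtain ⟨lβ, hlβ, _⟩ := dirichlet_test f (fun n => (n:ℝ) ^ (-β)) B 1 hBb (by intro n _; positivity)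
        (by
          intro n hn
          have hn' : (0:ℝ) < n := by exact_mod_cast hn
          apply Real.rpow_le_rpow_of_nonpos hn' (by push_cast; linarith) (by linarith)) hlim0
      have hz := LFunction_eq_limit (jchar d) hne1 f hχf B hBb β hβpos hβ2 lβ hlβ
      rw [hβ0] at hz
      have hlb0 : lβ = 0 := by exact_mod_cast hz.symm
      rw [hlb0] at hlβ
      have hsi := siegel_ineq hRC B hBb (1 - β) (by linarith) (by linarith)
        (by
          have e : (1 - β - 1 : ℝ) = -β := by ring
          rw [e]; exact hlβ) x hx
      have e1 : ∑ n ∈ Finset.Ioc 0 x, f n / n = Ssum d x := rfl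
      have e2 : ∑ m ∈ Finset.Ioc 0 x, f m / m * ∑ k ∈ Finset.Ioc 0 (x/m), 1/(k:ℝ) = Rsum d x := rfl
      rw [e1, e2] at hsi
      have h5 : (1 - β) * Rsum d x ≤ (1 / 8 / LD) * Rsum d x := by gcongr
      linarith
    · have hz := LFunction_eq_limit (jchar d) hne1 f hχf B hBb β hβpos hβ2 l (by
        rw [heq]
        refine hlt.congr ?_
        intro N
        apply Finset.sum_congr rfl
        intro n _
        rw [Real.rpow_neg_one, div_eq_mul_inv])
      rw [hβ0] at hz
      have : l = 0 := by exact_mod_cast hz.symm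
      linarith
  · obtain ⟨L, hL, hLl⟩ := hRC.curly B hBb l hlt hl hl0
    refine ⟨L, ?_, ?_⟩
    · unfold HasCurlyL
      refine hL.congr ?_
      intro y
      apply Finset.sum_congr rfl
      intro p _
      rw [hχf p, Complex.ofReal_re]
    · have : Real.log (τ - 1/4) ≤ Real.log l := Real.log_le_log (by linarith) hlS
      linarith

theorem P_props (z : ℕ) (hz : 2 ≤ z) : 8 ∣ 4 * primorial z ∧ (∀ p, p.Prime → p ≤ z → p ∣ 4 * primorial z) ∧
    (∀ p, p.Prime → p ∣ 4 * primorial z → p ≤ z) := by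
  have h1 : ∀ p, p.Prime → p ≤ z → p ∣ primorial z := by
    intro p hp hpz
    unfold primorial
    apply Finset.dvd_prod_of_mem (fun p => p)
    simp [hp]; omega
  refine ⟨?_, ?_, ?_⟩
  · have := h1 2 Nat.prime_two hz
    exact Nat.mul_dvd_mul_left 4 this
  · intro p hp hpz
    exact (h1 p hp hpz).mul_left 4
  · intro p hp hd
    rcases hp.dvd_mul.1 hd with h | h
    · have h2 : p ∣ 2 ^ 2 := h
      have := hp.dvd_of_dvd_pow h2
      have := Nat.le_of_dvd (by norm_num) this
      omega
    · unfold primorial at h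
      obtain ⟨q, hq, hpq⟩ := (hp.prime.dvd_finsetProd_iff _).1 h
      simp only [Finset.mem_filter, Finset.mem_range] at hq
      rw [(Nat.prime_dvd_prime_iff_eq hp hq.2).1 hpq]
      omega

theorem Hs_le (x : ℕ) : Hs x ≤ 1 + Real.log x := by
  have h := harmonic_le_one_add_log x
  have e : ((harmonic x : ℚ) : ℝ) = Hs x := by
    unfold Hs
    rw [harmonic_eq_sum_Icc]
    push_cast
    apply Finset.sum_congr
    · ext; simp [Nat.lt_iff_add_one_le]
    · intros; simp
  rw [← e]
  exact h

set_option maxHeartbeats 4000000 in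
open Classical in
theorem core (δ D q u LD : ℝ) (hδ : 0 < δ) (hδ1 : δ ≤ 1) (hD : D = q ^ 8) (hq : 96 ≤ q) (hLD : LD = Real.log D)
    (hu : u = D ^ δ) (huq : u ≤ q) (hE1 : 16 ≤ LD) (hE3 : 16 * (LD + 1) ≤ q ^ 2)
    (hE5 : 8 / 3 * (4 / δ + 2) ≤ Real.log (δ / 2 * LD)) (hE5' : 8 ≤ Real.log (δ / 2 * LD))
    (hE6 : Real.sqrt LD ≤ δ / 2 * LD) (hE7 : 4 ≤ δ / 2 * LD) :
    D / u / (32 * LD) ≤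
        (Nat.card {d : ℕ // (d : ℝ) ≤ D ∧ IsFundamentalDiscriminant d ∧
            ∃ χ : DirichletCharacter ℂ d, χ.IsPrimitive ∧ MulChar.IsQuadratic χ ∧
              HasNoSiegelZero (1/16) d χ ∧
              ∃ L : ℝ, HasCurlyL χ L ∧ Real.log (Real.log (Real.log D)) - (Real.log 32 + 6) ≤ L} : ℝ) := by
  have hq0 : 0 < q := by linarith
  have hDpos : 0 < D := by rw [hD]; positivity
  have hu0 : 0 < u := by rw [hu]; positivity
  have hLD8 : LD = 8 * Real.log q := by rw [hLD, hD, Real.log_pow]; norm_num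
  obtain ⟨z, hzdef⟩ : ∃ w, w = ⌊δ / 2 * LD⌋₊ := ⟨_, rfl⟩
  have hz4 : 4 ≤ z := by rw [hzdef]; exact Nat.le_floor (by exact_mod_cast hE7)
  have hzle : (z:ℝ) ≤ δ / 2 * LD := by rw [hzdef]; exact Nat.floor_le (by linarith)
  have hzlt : δ / 2 * LD < z + 1 := by rw [hzdef]; exact Nat.lt_floor_add_one _
  obtain ⟨P, hPdef⟩ : ∃ w, w = 4 * primorial z := ⟨_, rfl⟩
  obtain ⟨h8, hP, hP'⟩ := P_props z (by omega)
  rw [← hPdef] at h8 hP hP'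
  have hP0 : 0 < P := by have := primorial_pos z; omega
  have hPr : (0:ℝ) < P := by exact_mod_cast hP0
  have hP1 : (1:ℝ) ≤ P := by exact_mod_cast hP0
  have hPle : (P:ℝ) ≤ 4 * u := by
    have h1 : (primorial z : ℝ) ≤ 4 ^ z := by exact_mod_cast primorial_le_four_pow z
    have h2 : (4:ℝ) ^ z ≤ u := by
      have h3 : (4:ℝ) ≤ Real.exp 2 := by
        have := Real.add_one_le_exp (1:ℝ)
        have e : Real.exp 2 = Real.exp 1 * Real.exp 1 := by rw [← Real.exp_add]; norm_num
        rw [e]; nlinarith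
      calc (4:ℝ) ^ z ≤ (Real.exp 2) ^ z := by gcongr
        _ = Real.exp (z * 2) := by rw [← Real.exp_nat_mul]
        _ ≤ Real.exp (Real.log D * δ) := by
            apply Real.exp_le_exp.2
            rw [← hLD]; nlinarith
        _ = u := by rw [hu, Real.rpow_def_of_pos hDpos]
    rw [hPdef]; push_cast; linarith
  obtain ⟨K, hKdef⟩ : ∃ w, w = ⌊(D - 1) / (2 * (P:ℝ))⌋₊ := ⟨_, rfl⟩
  obtain ⟨x, hxdef⟩ : ∃ w, w = ⌊q ^ 6⌋₊ := ⟨_, rfl⟩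
  obtain ⟨Y, hYdef⟩ : ∃ w, w = ⌈q ^ 4⌉₊ := ⟨_, rfl⟩
  have hq2 : 96 * 96 ≤ q ^ 2 := by nlinarith
  have hq4 : 1 ≤ q ^ 4 := one_le_pow₀ (by linarith)
  have hq6 : 2 ≤ q ^ 6 := by
    have e : q ^ 6 = q ^ 4 * q ^ 2 := by ring
    rw [e]; nlinarith
  have hq7 : (96:ℝ) * q ^ 6 ≤ q ^ 7 := by
    have e : q ^ 7 = q * q ^ 6 := by ring
    rw [e]; gcongr
  have hD8 : D = q * q ^ 7 := by rw [hD]; ring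
  have hD1 : 2 ≤ D := by rw [hD8]; nlinarith
  have hKle : (K:ℝ) ≤ (D - 1) / (2 * P) := by
    rw [hKdef]; exact Nat.floor_le (by apply div_nonneg <;> linarith)
  have h2PK : 1 + 2 * P * K ≤ D := by
    rw [le_div_iff₀ (by linarith)] at hKle
    linarith
  have hDu : q ^ 7 ≤ D / u := by
    rw [le_div_iff₀ hu0, hD8]
    have : (0:ℝ) ≤ q ^ 7 := by positivity
    nlinarith
  have hKge : D / u / 32 ≤ K := by
    have h1 : (D - 1) / (2 * P) < K + 1 := by rw [hKdef]; exact Nat.lt_floor_add_one _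
    have h2 : D / u / 16 ≤ (D - 1) / (2 * P) := by
      calc D / u / 16 = (D / 2) / (2 * (4 * u)) := by field_simp; norm_num
        _ ≤ (D - 1) / (2 * P) := by
          apply div_le_div₀ <;> linarith
    linarith
  have hKq : q ^ 7 / 32 ≤ K := by linarith
  have hKq6 : 3 * q ^ 6 ≤ K := by linarith
  have hK0r : (0:ℝ) < K := by linarith
  have hK0 : 0 < K := by exact_mod_cast hK0r
  have hx0 : 1 ≤ x := by rw [hxdef]; exact Nat.le_floor (by push_cast; linarith)
  have hxr : (x:ℝ) ≤ q ^ 6 := by rw [hxdef]; exact Nat.floor_le (by positivity)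
  have hxg : q ^ 6 / 2 ≤ x := by
    have := Nat.lt_floor_add_one (q ^ 6)
    rw [← hxdef] at this
    linarith
  have hzLD : (z:ℝ) ≤ LD := by nlinarith
  have hzq : (z:ℝ) ≤ q ^ 2 := by linarith
  have hq24 : q ^ 2 ≤ q ^ 4 := pow_le_pow_right₀ (by linarith) (by norm_num)
  have hq46 : q ^ 4 ≤ q ^ 6 := pow_le_pow_right₀ (by linarith) (by norm_num)
  have hzx : z ≤ x := by rw [hxdef]; exact Nat.le_floor (by linarith)
  have hYge : q ^ 4 ≤ Y := by rw [hYdef]; exact Nat.le_ceil _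
  have hYle : (Y:ℝ) ≤ q ^ 4 + 1 := by rw [hYdef]; exact (Nat.ceil_lt_add_one (by positivity)).le
  have hzY : z ≤ Y := by
    have : (z:ℝ) ≤ Y := by linarith
    exact_mod_cast this
  have hY : 1 + 2 * P * K ≤ Y ^ 2 := by
    have h1 : ((1 + 2 * P * K : ℕ) : ℝ) ≤ ((Y ^ 2 : ℕ) : ℝ) := by
      push_cast
      calc _ ≤ D := h2PK
        _ = (q ^ 4) ^ 2 := by rw [hD]; ring
        _ ≤ _ := by gcongr
    exact_mod_cast h1
  have hHx : Hs x ≤ LD := by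
    have h1 := Hs_le x
    have h2 : Real.log x ≤ Real.log (q ^ 6) := Real.log_le_log (by exact_mod_cast hx0) hxr
    rw [Real.log_pow] at h2
    push_cast at h2
    linarith
  have hLDp : 0 < LD := by linarith
  obtain ⟨τ, hτ⟩ : ∃ w, w = Real.log ((z:ℝ) + 1) / 8 := ⟨_, rfl⟩
  have hlogz : Real.log (δ / 2 * LD) ≤ Real.log (z + 1) := Real.log_le_log (by linarith) hzlt.le
  have hτ1 : 1 ≤ τ := by rw [hτ]; linarith
  have hfc := family_count z P K x Y (1 / 8 / LD) τ LD (by omega) h8 hP0 hK0 hP hP' hzx hY hzY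
    (by positivity) (by
      calc 1 / 8 / LD * Hs x ≤ 1 / 8 / LD * LD := by gcongr
        _ = 1 / 8 := by field_simp
        _ ≤ 1 / 4 := by norm_num) hHx (by linarith)
  set G := (Finset.range K).filter (fun j => Squarefree (fam P K j) ∧
        τ ≤ Ssum (fam P K j) x - (1 / 8 / LD) * Rsum (fam P K j) x) with hG
  have hzr : (0:ℝ) < z := by exact_mod_cast (by omega : 0 < z)
  have hGcard : D / u / (32 * LD) ≤ (G.card : ℝ) := by
    have h1 : LD / z ≤ 4 / δ := by
      rw [div_le_div_iff₀ hzr hδ]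
      linarith
    have h2 : LD * (K / z + Y) ≤ K * (4 / δ) + LD * (2 * q ^ 4) := by
      have e : LD * (K / z + Y) = K * (LD / z) + LD * Y := by ring
      rw [e]
      gcongr
      linarith
    have h3 : LD * (2 * q ^ 4) ≤ q ^ 6 := by
      have e : q ^ 6 = q ^ 2 * q ^ 4 := by ring
      rw [e]
      have : (0:ℝ) < q ^ 4 := by positivity
      nlinarith
    have h4 : K * (8 / 3 * (4 / δ + 2)) ≤ K * Real.log (z + 1) := by
      gcongr; linarith
    have h5 : (K:ℝ) ≤ LD * G.card := by
      have e : τ * K = K * Real.log (z + 1) / 8 := by rw [hτ]; ring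
      rw [e] at hfc
      nlinarith
    rw [← div_div, div_le_iff₀ hLDp]
    linarith
  refine hGcard.trans ?_
  have hinj : Function.Injective (fam P K) := by
    intro a b hab
    unfold fam at hab
    have h1 : P * (K + a) = P * (K + b) := by omega
    have := Nat.eq_of_mul_eq_mul_left hP0 h1
    omega
  rw [← Finset.card_image_of_injective G hinj]
  set T : Set ℕ := {d : ℕ | (d : ℝ) ≤ D ∧ IsFundamentalDiscriminant d ∧
            ∃ χ : DirichletCharacter ℂ d, χ.IsPrimitive ∧ MulChar.IsQuadratic χ ∧
              HasNoSiegelZero (1/16) d χ ∧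
              ∃ L : ℝ, HasCurlyL χ L ∧ Real.log (Real.log (Real.log D)) - (Real.log 32 + 6) ≤ L} with hT
  have hTfin : T.Finite := by
    apply (Set.finite_Iic ⌊D⌋₊).subset
    intro d hd
    exact Nat.le_floor hd.1
  have hsub : ((G.image (fam P K) : Finset ℕ) : Set ℕ) ⊆ T := by
    intro d hd
    rw [Finset.mem_coe, Finset.mem_image] at hd
    obtain ⟨j, hj, rfl⟩ := hd
    rw [hG, Finset.mem_filter, Finset.mem_range] at hj
    obtain ⟨hjK, hsf, hX⟩ := hj
    have hd4 : fam P K j % 4 = 1 := by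
      obtain ⟨r, hr⟩ := h8
      unfold fam
      rw [hr, mul_assoc]; omega
    have hdle : (fam P K j : ℝ) ≤ D := by
      have h1 : fam P K j ≤ 1 + 2 * P * K := by
        unfold fam
        have : P * (K + j) ≤ P * (2 * K) := Nat.mul_le_mul_left _ (by omega)
        nlinarith
      have h2 : (fam P K j : ℝ) ≤ ((1 + 2 * P * K : ℕ) : ℝ) := by exact_mod_cast h1
      push_cast at h2
      linarith
    have hdgeK : K ≤ fam P K j := by
      unfold fam
      have : 1 * (K + j) ≤ P * (K + j) := Nat.mul_le_mul_right _ hP0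
      omega
    have hdge : q ^ 4 ≤ (fam P K j : ℝ) := by
      have : (K:ℝ) ≤ fam P K j := by exact_mod_cast hdgeK
      linarith
    have hd1 : 1 < fam P K j := by
      unfold fam
      have : 0 < P * (K + j) := by positivity
      omega
    have hdr : (0:ℝ) < fam P K j := by linarith
    have hlogd : LD / 2 ≤ Real.log (fam P K j) := by
      have := Real.log_le_log (by positivity) hdge
      rw [Real.log_pow] at this
      push_cast at this
      linarith
    have hlogd2 : Real.log (fam P K j) ≤ LD := by
      rw [hLD]; exact Real.log_le_log hdr hdle
    have hsq : Real.sqrt (fam P K j) ≤ q ^ 4 := by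
      apply Real.sqrt_le_iff.2
      refine ⟨by positivity, ?_⟩
      calc _ ≤ D := hdle
        _ = _ := by rw [hD]; ring
    have hB : 2 * (Real.sqrt (fam P K j) * (Real.log (fam P K j) + 1)) / x ≤ 1 / 4 := by
      rw [div_le_iff₀ (by exact_mod_cast hx0)]
      have h1 : Real.sqrt (fam P K j) * (Real.log (fam P K j) + 1) ≤ q ^ 4 * (LD + 1) := by
        gcongr
      have h2 : q ^ 4 * (16 * (LD + 1)) ≤ q ^ 4 * q ^ 2 := by gcongr
      have e : q ^ 4 * q ^ 2 = q ^ 6 := by ring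
      rw [e] at h2
      linarith
    obtain ⟨χ, h1, h2, h3, L, h4, h5⟩ := good_d (fam P K j) x LD τ hd1 hd4 hsf hx0 hE1 hlogd hB hτ1 hX
    refine ⟨hdle, ⟨by omega, Or.inl ⟨hd4, hsf⟩⟩, χ, h1, h2, h3, L, h4, ?_⟩
    refine le_trans ?_ h5
    rw [← hLD]
    have hll : 0 < Real.log LD := Real.log_pos (by linarith)
    have a1 : Real.log LD / 2 ≤ Real.log (z + 1) := by
      rw [← Real.log_sqrt hLDp.le]
      refine le_trans (Real.log_le_log (Real.sqrt_pos.2 hLDp) hE6) hlogz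
    have a2 : Real.log LD / 32 ≤ τ - 1 / 4 := by
      rw [hτ]; linarith
    have a3 := Real.log_le_log (by positivity) a2
    rw [Real.log_div hll.ne' (by norm_num)] at a3
    linarith
  have := Set.ncard_le_ncard hsub hTfin
  rw [Set.ncard_coe_finset] at this
  have e : Nat.card {d : ℕ // d ∈ T} = T.ncard := rfl
  exact_mod_cast this

/-- fix `ε > 0`. There are constants `c, A > 0` such that for all large `D`
there are at least `D^{1-ε}` fundamental discriminants `d ≤ D` with
`𝓛_{χ_d} ≥ log log log D - A` and no Siegel zero for `L(s, χ_d)`. -/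
theorem statement_5 (ε : ℝ) (hε : 0 < ε) :
    ∃ c > (0:ℝ), ∃ A > (0:ℝ), ∀ᶠ D : ℝ in atTop,
      D ^ (1 - ε) ≤
        (Nat.card {d : ℕ // (d : ℝ) ≤ D ∧ IsFundamentalDiscriminant d ∧
            ∃ χ : DirichletCharacter ℂ d, χ.IsPrimitive ∧ MulChar.IsQuadratic χ ∧
              HasNoSiegelZero c d χ ∧
              ∃ L : ℝ, HasCurlyL χ L ∧ Real.log (Real.log (Real.log D)) - A ≤ L} : ℝ) := by
  have hA : 0 < Real.log 32 + 6 := by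
    have := Real.log_pos (by norm_num : (1:ℝ) < 32)
    linarith
  refine ⟨1/16, by norm_num, Real.log 32 + 6, hA, ?_⟩
  set δ := min ε (1/4) / 2 with hδdef
  have hδ : 0 < δ := by rw [hδdef]; positivity
  have hδ8 : δ ≤ 1 / 8 := by
    have := min_le_right ε (1/4)
    rw [hδdef]; linarith
  have hδε : 2 * δ ≤ ε := by
    have := min_le_left ε (1/4)
    rw [hδdef]; linarith
  have hlog : Tendsto Real.log atTop atTop := Real.tendsto_log_atTop
  have hδlog : Tendsto (fun D => δ / 2 * Real.log D) atTop atTop := hlog.const_mul_atTop (by positivity)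
  have hloglog : Tendsto (fun D => Real.log (δ / 2 * Real.log D)) atTop atTop := hlog.comp hδlog
  have hE2 : ∀ᶠ D : ℝ in atTop, 32 * Real.log D ≤ D ^ δ := by
    have := (isLittleO_log_rpow_atTop hδ).bound (c := 1/32) (by norm_num)
    filter_upwards [this, eventually_ge_atTop 1] with D h h1
    have h2 := Real.log_nonneg h1
    rw [Real.norm_of_nonneg h2, Real.norm_of_nonneg (by positivity)] at h
    linarith
  have hE3 : ∀ᶠ D : ℝ in atTop, 32 * Real.log D ≤ D ^ (1/4 : ℝ) := by
    have := (isLittleO_log_rpow_atTop (by norm_num : (0:ℝ) < 1/4)).bound (c := 1/32) (by norm_num)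
    filter_upwards [this, eventually_ge_atTop 1] with D h h1
    have h2 := Real.log_nonneg h1
    rw [Real.norm_of_nonneg h2, Real.norm_of_nonneg (by positivity)] at h
    linarith
  have hE4 : ∀ᶠ D : ℝ in atTop, 96 ≤ D ^ (1/8 : ℝ) :=
    (tendsto_rpow_atTop (by norm_num : (0:ℝ) < 1/8)).eventually_ge_atTop 96
  filter_upwards [hE2, hE3, hE4, hlog.eventually_ge_atTop 16, hloglog.eventually_ge_atTop (8 / 3 * (4 / δ + 2)),
    hloglog.eventually_ge_atTop 8, hδlog.eventually_ge_atTop 4, hlog.eventually_ge_atTop (4 / δ ^ 2),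
    eventually_ge_atTop 1] with D e2 e3 e4 e1 e5 e5' e7 e6 hD1
  have hD0 : 0 < D := by linarith
  have hcore := core δ D (D ^ (1/8 : ℝ)) (D ^ δ) (Real.log D) hδ (by linarith)
    (by rw [← Real.rpow_natCast, ← Real.rpow_mul hD0.le]; norm_num) e4 rfl rfl
    (Real.rpow_le_rpow_of_exponent_le hD1 hδ8) e1
    (by
      have : (D ^ (1/8 : ℝ)) ^ 2 = D ^ (1/4 : ℝ) := by
        rw [← Real.rpow_natCast, ← Real.rpow_mul hD0.le]; norm_num
      rw [this]; linarith)
    e5 e5'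
    (by
      rw [Real.sqrt_le_iff]
      refine ⟨by linarith, ?_⟩
      rw [div_le_iff₀ (by positivity)] at e6
      nlinarith) e7
  refine le_trans ?_ hcore
  have hL0 : 0 < Real.log D := by linarith
  have hu0 : 0 < D ^ δ := by positivity
  rw [div_div, le_div_iff₀ (by positivity)]
  calc D ^ (1 - ε) * (D ^ δ * (32 * Real.log D)) ≤ D ^ (1 - ε) * (D ^ δ * D ^ δ) := by gcongr
    _ = D ^ (1 - ε + (δ + δ)) := by rw [← Real.rpow_add hD0, ← Real.rpow_add hD0]
    _ ≤ D ^ (1:ℝ) := Real.rpow_le_rpow_of_exponent_le hD1 (by linarith)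
    _ = D := Real.rpow_one D
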